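/- arXiv:2011.01099 — 8 statements merged into one kernel-verified Lean document; each statement's English description precedes it below -/
import Mathlib

section
/- The positive integers x, y with gcd(x, y) = 1 and non-negative integers k, ℓ, m satisfy x² + 2^k·11^ℓ·19^m = y⁴ if and only if (x, y, k, ℓ, m) is one of the five tuples (7,3,5,0,0), (193,15,6,1,1), (27,7,3,1,1), (487,27,7,2,1), (1293,37,3,3,1). -/
/-- Periodicity of the powers of `b` modulo `Q`, with a factor `c` absorbing common divisors. -/
theorem mul_pow_modEq_mul_pow_mod {b N Q c : ℕ} (h : c * b ^ N ≡ c [MOD Q]) (n : ℕ) :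
    c * b ^ n ≡ c * b ^ (n % N) [MOD Q] := by
  have key : ∀ q, c * b ^ (N * q) ≡ c [MOD Q] := by
    intro q
    induction q with
    | zero => simp [Nat.ModEq.refl]
    | succ q ih =>
      calc c * b ^ (N * (q + 1)) = c * b ^ (N * q) * b ^ N := by ring
        _ ≡ c * b ^ N [MOD Q] := ih.mul_right _
        _ ≡ c [MOD Q] := h
  calc c * b ^ n = c * b ^ (N * (n / N)) * b ^ (n % N) := by
        rw [mul_assoc, ← pow_add, Nat.div_add_mod]
    _ ≡ c * b ^ (n % N) [MOD Q] := (key _).mul_right _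

theorem pow_modEq_pow_mod {b N Q : ℕ} (h : b ^ N ≡ 1 [MOD Q]) (n : ℕ) :
    b ^ n ≡ b ^ (n % N) [MOD Q] := by
  simpa using mul_pow_modEq_mul_pow_mod (c := 1) (by simpa using h) n

/-- Multiplication of `a.1 + a.2 √d` and `b.1 + b.2 √d` modulo `Q`. -/
def mulMod (d Q : ℕ) (a b : ℕ × ℕ) : ℕ × ℕ :=
  ((a.1 * b.1 + d * (a.2 * b.2)) % Q, (a.1 * b.2 + a.2 * b.1) % Q)

/-- Powers of `a.1 + a.2 √d` modulo `Q` by repeated squaring; correct for exponents below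
`2 ^ fuel`. -/
def powMod (d Q : ℕ) (a : ℕ × ℕ) : ℕ → ℕ → ℕ × ℕ
  | 0, _ => (1, 0)
  | fuel + 1, n =>
    if n % 2 = 0 then powMod d Q (mulMod d Q a a) fuel (n / 2)
    else mulMod d Q a (powMod d Q (mulMod d Q a a) fuel (n / 2))

/-- The second coordinate of `a ^ n * b ^ l` modulo `Q`, for exponents below `2 ^ 12`. -/
def imMod (d Q : ℕ) (a b : ℕ × ℕ) (n l : ℕ) : ℕ :=
  (mulMod d Q (powMod d Q a 12 n) (powMod d Q b 12 l)).2

theorem imMod_lt {d Q : ℕ} (hQ : 0 < Q) (a b : ℕ × ℕ) (n l : ℕ) : imMod d Q a b n l < Q :=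
  Nat.mod_lt _ hQ

/-- Reduction of `ℤ√d` modulo the integer `Q`. -/
abbrev redMod (d Q : ℕ) : ℤ√(d : ℤ) →+* ℤ√(d : ℤ) ⧸ Ideal.span {((Q : ℤ) : ℤ√(d : ℤ))} :=
  Ideal.Quotient.mk _

theorem redMod_eq_iff {d Q : ℕ} {x y : ℤ√(d : ℤ)} :
    redMod d Q x = redMod d Q y ↔ x.re ≡ y.re [ZMOD Q] ∧ x.im ≡ y.im [ZMOD Q] := by
  rw [Ideal.Quotient.eq, Ideal.mem_span_singleton, Zsqrtd.intCast_dvd, Zsqrtd.re_sub,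
    Zsqrtd.im_sub, ← Int.modEq_iff_dvd, ← Int.modEq_iff_dvd]
  exact ⟨fun h => ⟨h.1.symm, h.2.symm⟩, fun h => ⟨h.1.symm, h.2.symm⟩⟩

/-- The element `a.1 + a.2 √d` of `ℤ√d`. -/
def ofPair (d : ℕ) (a : ℕ × ℕ) : ℤ√(d : ℤ) := ⟨a.1, a.2⟩

theorem redMod_mulMod (d Q : ℕ) (a b : ℕ × ℕ) :
    redMod d Q (ofPair d (mulMod d Q a b)) =
      redMod d Q (ofPair d a) * redMod d Q (ofPair d b) := by
  rw [← map_mul, redMod_eq_iff]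
  simp only [ofPair, mulMod, Zsqrtd.re_mul, Zsqrtd.im_mul]
  push_cast
  constructor
  · rw [mul_assoc]
    exact Int.mod_modEq _ _
  · exact Int.mod_modEq _ _

theorem redMod_powMod (d Q : ℕ) (fuel : ℕ) : ∀ (a : ℕ × ℕ) (n : ℕ), n < 2 ^ fuel →
    redMod d Q (ofPair d (powMod d Q a fuel n)) = redMod d Q (ofPair d a) ^ n := by
  induction fuel with
  | zero =>
    intro a n hn
    obtain rfl : n = 0 := by simpa using hn
    rw [pow_zero, ← map_one (redMod d Q)]
    exact congrArg _ (Zsqrtd.ext (by simp [ofPair, powMod]) (by simp [ofPair, powMod]))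
  | succ fuel ih =>
    intro a n hn
    have hlt : n / 2 < 2 ^ fuel := by rw [pow_succ] at hn; omega
    have hsq : redMod d Q (ofPair d (powMod d Q (mulMod d Q a a) fuel (n / 2))) =
        redMod d Q (ofPair d a) ^ (2 * (n / 2)) := by
      rw [ih _ _ hlt, redMod_mulMod, ← sq, pow_mul]
    rw [powMod]
    split_ifs with h
    · rw [hsq]
      congr 1
      omega
    · rw [redMod_mulMod, hsq, ← pow_succ']
      congr 1
      omega

theorem redMod_pow_eq_one {d Q N : ℕ} {a : ℕ × ℕ} (hN : N < 2 ^ 12)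
    (h : powMod d Q a 12 N = (1, 0)) : redMod d Q (ofPair d a) ^ N = 1 := by
  rw [← redMod_powMod d Q 12 a N hN, h, ← map_one (redMod d Q)]
  exact congrArg _ (Zsqrtd.ext (by simp [ofPair]) (by simp [ofPair]))

/-- The imaginary part of `a ^ n * b ^ l` modulo `Q` depends only on the exponents modulo a common
period `N`. -/
theorem im_modEq_imMod {d Q N : ℕ} {a b : ℕ × ℕ} (hN₀ : 0 < N) (hN : N < 2 ^ 12)
    (ha : powMod d Q a 12 N = (1, 0)) (hb : powMod d Q b 12 N = (1, 0)) {x : ℤ√(d : ℤ)} {n l : ℕ}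
    (hx : redMod d Q x = redMod d Q (ofPair d a) ^ n * redMod d Q (ofPair d b) ^ l) :
    x.im ≡ (imMod d Q a b (n % N) (l % N) : ℕ) [ZMOD Q] := by
  have hn : n % N < 2 ^ 12 := (Nat.mod_lt _ hN₀).trans hN
  have hl : l % N < 2 ^ 12 := (Nat.mod_lt _ hN₀).trans hN
  rw [pow_eq_pow_mod n (redMod_pow_eq_one hN ha), pow_eq_pow_mod l (redMod_pow_eq_one hN hb),
    ← redMod_powMod d Q 12 a _ hn, ← redMod_powMod d Q 12 b _ hl, ← redMod_mulMod,
    redMod_eq_iff] at hx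
  exact hx.2

/-- Over a ring where `ε` has period `N`, an integral power of a Pell solution is a natural power,
with an exponent that does not depend on the modulus. -/
theorem exists_redMod_zpow_eq_pow {d : ℕ} (ε : Pell.Solution₁ (d : ℤ)) (k : ℤ) (N : ℕ)
    (hN : 0 < N) : ∃ n : ℕ, ∀ Q : ℕ, redMod d Q (ε : ℤ√(d : ℤ)) ^ N = 1 →
      redMod d Q ((ε ^ k : Pell.Solution₁ (d : ℤ)) : ℤ√(d : ℤ)) =
        redMod d Q (ε : ℤ√(d : ℤ)) ^ n := by
  have hpow : ∀ (n : ℕ), ((ε ^ n : Pell.Solution₁ (d : ℤ)) : ℤ√(d : ℤ)) = (ε : ℤ√(d : ℤ)) ^ n :=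
    fun n => rfl
  have hmul : ∀ a b : Pell.Solution₁ (d : ℤ),
    ((a * b : Pell.Solution₁ (d : ℤ)) : ℤ√(d : ℤ)) = a * b := fun a b => rfl
  refine ⟨(k % N).toNat, fun Q hQ => ?_⟩
  have hk : (((k % N).toNat : ℕ) : ℤ) = k % N :=
    Int.toNat_of_nonneg (Int.emod_nonneg _ (by omega))
  have hε : ∀ j : ℕ, redMod d Q ((ε ^ (N * j) : Pell.Solution₁ (d : ℤ)) : ℤ√(d : ℤ)) = 1 := by
    intro j
    rw [hpow, map_pow, pow_mul, hQ, one_pow]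
  have hkey : ∀ (a : Pell.Solution₁ (d : ℤ)) (j : ℤ),
      redMod d Q ((a * ε ^ ((N : ℤ) * j) : Pell.Solution₁ (d : ℤ)) : ℤ√(d : ℤ)) =
        redMod d Q (a : ℤ√(d : ℤ)) := by
    intro a j
    obtain ⟨j, rfl | rfl⟩ := j.eq_nat_or_neg
    · have : ε ^ ((N : ℤ) * (j : ℤ)) = ε ^ (N * j) := by
        rw [← zpow_natCast]; push_cast; rfl
      rw [this, hmul, map_mul, hε, mul_one]
    · have : ε ^ ((N : ℤ) * -(j : ℤ)) * ε ^ (N * j) = 1 := by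
        rw [← zpow_natCast, ← zpow_add]; push_cast; simp
      calc _ = redMod d Q ((a * ε ^ ((N : ℤ) * -(j : ℤ)) : Pell.Solution₁ (d : ℤ)) : ℤ√(d : ℤ)) *
            redMod d Q ((ε ^ (N * j) : Pell.Solution₁ (d : ℤ)) : ℤ√(d : ℤ)) := by
              rw [hε, mul_one]
        _ = _ := by rw [← map_mul, ← hmul, mul_assoc, this, mul_one]
  have hlast := hkey (ε ^ (k % N).toNat) (k / N)
  have hexp : ε ^ (k % N).toNat * ε ^ ((N : ℤ) * (k / N)) = ε ^ k := by
    rw [← zpow_natCast, ← zpow_add, hk, Int.emod_add_mul_ediv]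
  rw [hexp] at hlast
  exact hlast.trans ((congrArg _ (hpow _)).trans (map_pow _ _ _))

/-- The congruence `± 19 ^ (i + 1) ≡ im ((37 + 6√38) ^ n * (7 + √38) ^ l)` modulo `Q` for a tuple
`(n, l, i, s)`, where the sign is negative when `s` is `true`. -/
def imEq (Q : ℕ) (v : ℕ × ℕ × ℕ × Bool) : Bool :=
  imMod 38 Q (37, 6) (7, 1) v.1 v.2.1 == (bif v.2.2.2 then Q - 1 else 1) * (19 * 19 ^ v.2.2.1) % Q

/-- Every lift modulo `N * q` of a class in `S` modulo `N` that satisfies the congruence modulo `Q`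
lies in `R`. The test modulo `gcd Q 19` is implied by the congruence and only saves time. -/
def refines (Q N q : ℕ) (S R : List (ℕ × ℕ × ℕ × Bool)) : Bool :=
  S.all fun v => (List.range q).all fun a => (List.range q).all fun b =>
    imMod 38 Q (37, 6) (7, 1) (v.1 + N * a) (v.2.1 + N * b) % Nat.gcd Q 19 != 0 ||
      (List.range q).all fun c =>
        !imEq Q (v.1 + N * a, v.2.1 + N * b, v.2.2.1 + N * c, v.2.2.2) ||
          R.contains (v.1 + N * a, v.2.1 + N * b, v.2.2.1 + N * c, v.2.2.2)

/-- The exponents of a tuple reduced modulo `N`. -/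
def tupleMod (N : ℕ) (v : ℕ × ℕ × ℕ × Bool) : ℕ × ℕ × ℕ × Bool :=
  (v.1 % N, v.2.1 % N, v.2.2.1 % N, v.2.2.2)

theorem imMod_mod_gcd_of_imEq {Q : ℕ} {v : ℕ × ℕ × ℕ × Bool} (h : imEq Q v = true) :
    imMod 38 Q (37, 6) (7, 1) v.1 v.2.1 % Nat.gcd Q 19 = 0 := by
  rw [imEq, beq_iff_eq] at h
  rw [h, Nat.mod_mod_of_dvd _ (Nat.gcd_dvd_left Q 19)]
  exact Nat.mod_eq_zero_of_dvd
    (((Nat.gcd_dvd_right Q 19).mul_right _).mul_left _)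

theorem mod_mul_eq_add {N q n : ℕ} (hN : 0 < N) (hq : 0 < q) :
    n % (N * q) = n % N + N * (n % (N * q) / N) ∧ n % (N * q) / N < q := by
  constructor
  · conv_lhs => rw [← Nat.mod_add_div (n % (N * q)) N]
    rw [Nat.mod_mod_of_dvd _ (Dvd.intro _ rfl)]
  · exact Nat.div_lt_of_lt_mul (Nat.mod_lt _ (Nat.mul_pos hN hq))

theorem mem_of_refines {Q N q : ℕ} {S R : List (ℕ × ℕ × ℕ × Bool)} (hN : 0 < N) (hq : 0 < q)
    (h : refines Q N q S R = true) {v : ℕ × ℕ × ℕ × Bool} (hv : tupleMod N v ∈ S)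
    (hQ : imEq Q (tupleMod (N * q) v) = true) : tupleMod (N * q) v ∈ R := by
  obtain ⟨n, l, i, s⟩ := v
  obtain ⟨hn, hn'⟩ := mod_mul_eq_add (n := n) hN hq
  obtain ⟨hl, hl'⟩ := mod_mul_eq_add (n := l) hN hq
  obtain ⟨hi, hi'⟩ := mod_mul_eq_add (n := i) hN hq
  have hgcd := imMod_mod_gcd_of_imEq hQ
  simp only [refines, List.all_eq_true] at h
  have h₁ := h _ hv _ (List.mem_range.2 hn') _ (List.mem_range.2 hl')
  simp only [tupleMod] at h₁ hQ hgcd ⊢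
  rw [← hn, ← hl, hgcd] at h₁
  simp only [bne_self_eq_false, Bool.false_or, List.all_eq_true] at h₁
  have h₂ := h₁ _ (List.mem_range.2 hi')
  rw [← hi, hQ] at h₂
  simpa using h₂

theorem imEq_tupleMod {Q N : ℕ} (hQ₀ : 0 < Q) (hN₀ : 0 < N) (hN : N < 2 ^ 12)
    (ha : powMod 38 Q (37, 6) 12 N = (1, 0)) (hb : powMod 38 Q (7, 1) 12 N = (1, 0))
    (hc : 19 * 19 ^ N ≡ 19 [MOD Q]) {x : ℤ√((38 : ℕ) : ℤ)} {n l i : ℕ} {s : Bool}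
    (hx : redMod 38 Q x = redMod 38 Q (ofPair 38 (37, 6)) ^ n * redMod 38 Q (ofPair 38 (7, 1)) ^ l)
    (him : x.im = (bif s then -1 else 1) * 19 ^ (i + 1)) :
    imEq Q (tupleMod N (n, l, i, s)) = true := by
  have h := im_modEq_imMod hN₀ hN ha hb hx
  have hp : (19 * 19 ^ i : ℤ) ≡ 19 * 19 ^ (i % N) [ZMOD Q] := by
    have := Int.natCast_modEq_iff.2 (mul_pow_modEq_mul_pow_mod hc i)
    push_cast at this
    exact this
  have hs : ((bif s then -1 else 1 : ℤ)) ≡ ((bif s then Q - 1 else 1 : ℕ) : ℤ) [ZMOD Q] := by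
    cases s
    · exact Int.ModEq.refl _
    · simp only [cond_true]
      rw [Nat.cast_sub hQ₀, Int.modEq_iff_dvd]
      simp
  rw [imEq, beq_iff_eq, ← Nat.mod_eq_of_lt (imMod_lt hQ₀ (37, 6) (7, 1) _ _)]
  refine Int.natCast_modEq_iff.1 (h.symm.trans ?_)
  rw [him, pow_succ']
  refine (hs.mul hp).trans ?_
  simp only [tupleMod]
  push_cast
  exact Int.ModEq.refl _

theorem refines_two_twelve : refines 260 2 6
    [(0, 1, 0, false), (0, 1, 1, false), (1, 1, 0, false), (1, 1, 1, false),
      (0, 1, 0, true), (0, 1, 1, true), (1, 1, 0, true), (1, 1, 1, true)]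
    [(0, 1, 11, false), (0, 7, 9, false), (2, 5, 9, false), (2, 11, 7, false), (4, 3, 5, false),
      (4, 9, 7, false), (6, 1, 5, false), (6, 7, 3, false), (8, 5, 3, false), (8, 11, 1, false),
      (10, 3, 11, false), (10, 9, 1, false), (1, 1, 5, true), (1, 7, 9, true), (3, 5, 3, true),
      (3, 11, 7, true), (5, 3, 5, true), (5, 9, 1, true), (7, 1, 11, true), (7, 7, 3, true),
      (9, 5, 9, true), (9, 11, 1, true), (11, 3, 11, true), (11, 9, 7, true)] = true := by
  decide +kernel

theorem refines_twelve_24 : refines 32760 12 2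
    [(0, 1, 11, false), (0, 7, 9, false), (2, 5, 9, false), (2, 11, 7, false), (4, 3, 5, false),
      (4, 9, 7, false), (6, 1, 5, false), (6, 7, 3, false), (8, 5, 3, false), (8, 11, 1, false),
      (10, 3, 11, false), (10, 9, 1, false), (1, 1, 5, true), (1, 7, 9, true), (3, 5, 3, true),
      (3, 11, 7, true), (5, 3, 5, true), (5, 9, 1, true), (7, 1, 11, true), (7, 7, 3, true),
      (9, 5, 9, true), (9, 11, 1, true), (11, 3, 11, true), (11, 9, 7, true)]
    [(0, 1, 11, false), (0, 1, 23, false), (16, 9, 7, false), (16, 9, 19, false),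
      (8, 17, 3, false), (8, 17, 15, false), (23, 3, 11, true), (23, 3, 23, true)] = true := by
  decide +kernel

theorem refines_24_456 : refines 8683 24 19
    [(0, 1, 11, false), (0, 1, 23, false), (16, 9, 7, false), (16, 9, 19, false),
      (8, 17, 3, false), (8, 17, 15, false), (23, 3, 11, true), (23, 3, 23, true)]
    [(144, 25, 395, false), (144, 25, 167, false), (416, 353, 411, false), (416, 353, 183, false),
      (95, 171, 35, true), (95, 171, 263, true)] = true := by
  decide +kernel

theorem refines_456_2280 : refines 442525 456 5
    [(144, 25, 395, false), (144, 25, 167, false), (416, 353, 411, false), (416, 353, 183, false),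
      (95, 171, 35, true), (95, 171, 263, true)] [] = true := by
  decide +kernel

/-- The solution `37 + 6√38` of the Pell equation. -/
def pell38 : Pell.Solution₁ ((38 : ℕ) : ℤ) := Pell.Solution₁.mk 37 6 (by norm_num)

/-- The imaginary part of `(37 + 6√38) ^ k * (7 + √38) ^ l` with `l` odd is never `± 19 ^ (i + 1)`. -/
theorem im_zpow_mul_pow_ne {k : ℤ} {l i : ℕ} (hl : Odd l) (s : Bool) :
    (((pell38 ^ k : Pell.Solution₁ ((38 : ℕ) : ℤ)) : ℤ√((38 : ℕ) : ℤ)) *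
      ofPair 38 (7, 1) ^ l).im ≠ (bif s then -1 else 1) * 19 ^ (i + 1) := by
  intro him
  obtain ⟨n, hn⟩ := exists_redMod_zpow_eq_pow pell38 k 2280 (by norm_num)
  have hε : (pell38 : ℤ√((38 : ℕ) : ℤ)) = ofPair 38 (37, 6) := rfl
  have hx : ∀ Q : ℕ, powMod 38 Q (37, 6) 12 2280 = (1, 0) →
      redMod 38 Q (((pell38 ^ k : Pell.Solution₁ ((38 : ℕ) : ℤ)) : ℤ√((38 : ℕ) : ℤ)) *
        ofPair 38 (7, 1) ^ l) =
      redMod 38 Q (ofPair 38 (37, 6)) ^ n * redMod 38 Q (ofPair 38 (7, 1)) ^ l := by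
    intro Q hQ
    rw [map_mul, map_pow]
    congr 1
    have := hn Q (by rw [hε]; exact redMod_pow_eq_one (by norm_num) hQ)
    rw [hε] at this
    exact this
  have h₂ : tupleMod 2 (n, l, i, s) ∈ [(0, 1, 0, false), (0, 1, 1, false), (1, 1, 0, false),
      (1, 1, 1, false), (0, 1, 0, true), (0, 1, 1, true), (1, 1, 0, true), (1, 1, 1, true)] := by
    rw [tupleMod, Nat.odd_iff.1 hl]
    rcases Nat.mod_two_eq_zero_or_one n with h | h <;>
      rcases Nat.mod_two_eq_zero_or_one i with h' | h' <;> cases s <;> simp [h, h']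
  have h₁₂ := mem_of_refines (by norm_num) (by norm_num) refines_two_twelve h₂
    (imEq_tupleMod (by norm_num) (by norm_num) (by norm_num) (by decide +kernel)
      (by decide +kernel) (by decide +kernel) (hx 260 (by decide +kernel)) him)
  have h₂₄ := mem_of_refines (by norm_num) (by norm_num) refines_twelve_24 h₁₂
    (imEq_tupleMod (by norm_num) (by norm_num) (by norm_num) (by decide +kernel)
      (by decide +kernel) (by decide +kernel) (hx 32760 (by decide +kernel)) him)
  have h₄₅₆ := mem_of_refines (by norm_num) (by norm_num) refines_24_456 h₂₄
    (imEq_tupleMod (by norm_num) (by norm_num) (by norm_num) (by decide +kernel)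
      (by decide +kernel) (by decide +kernel) (hx 8683 (by decide +kernel)) him)
  have h₂₂₈₀ := mem_of_refines (by norm_num) (by norm_num) refines_456_2280 h₄₅₆
    (imEq_tupleMod (by norm_num) (by norm_num) (by norm_num) (by decide +kernel)
      (by decide +kernel) (by decide +kernel) (hx 442525 (by decide +kernel)) him)
  exact absurd h₂₂₈₀ (by simp)

theorem isFundamental_pell38 : Pell.IsFundamental pell38 := by
  refine ⟨by decide, by decide, fun {b} hb => ?_⟩
  by_contra! hlt
  have hp := b.prop
  have hx : b.x < 37 := hlt
  generalize b.x = x at *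
  generalize b.y = y at *
  push_cast at hp
  have hy₁ : y < 6 := by nlinarith
  have hy₂ : -6 < y := by nlinarith
  interval_cases y <;> first | nlinarith | (interval_cases x <;> omega)

/-- The solution `10 + 3√11` of the Pell equation. -/
def pell11 : Pell.Solution₁ ((11 : ℕ) : ℤ) := Pell.Solution₁.mk 10 3 (by norm_num)

theorem isFundamental_pell11 : Pell.IsFundamental pell11 := by
  refine ⟨by decide, by decide, fun {b} hb => ?_⟩
  by_contra! hlt
  have hp := b.prop
  have hx : b.x < 10 := hlt
  generalize b.x = x at *
  generalize b.y = y at *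
  push_cast at hp
  have hy₁ : y < 3 := by nlinarith
  have hy₂ : -3 < y := by nlinarith
  interval_cases y <;> first | nlinarith | (interval_cases x <;> omega)

/-- An element of norm `11 ^ l` in `ℤ[√38]` divisible by `7 + √38` but not by `11` is a unit times
`(7 + √38) ^ l`. -/
theorem exists_pell_mul_pow (l : ℕ) : ∀ y z : ℤ, y ^ 2 - 38 * z ^ 2 = 11 ^ l →
    (l = 0 ∨ (11 ∣ y - 7 * z ∧ ¬ 11 ∣ z)) → ∃ u : Pell.Solution₁ ((38 : ℕ) : ℤ),
      (⟨y, z⟩ : ℤ√((38 : ℕ) : ℤ)) = (u : ℤ√((38 : ℕ) : ℤ)) * ofPair 38 (7, 1) ^ l := by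
  induction l with
  | zero =>
    intro y z h _
    refine ⟨Pell.Solution₁.mk y z (by push_cast; simpa using h), ?_⟩
    exact (mul_one _).symm
  | succ l ih =>
    intro y z h hd
    obtain ⟨⟨c, hc⟩, hz⟩ := hd.resolve_left (Nat.succ_ne_zero l)
    obtain rfl : y = 7 * z + 11 * c := by linarith
    have hnorm : (z + 7 * c) ^ 2 - 38 * c ^ 2 = 11 ^ l := by
      have : (11 : ℤ) * ((z + 7 * c) ^ 2 - 38 * c ^ 2) = 11 * 11 ^ l := by
        rw [← pow_succ', ← h]; ring
      exact mul_left_cancel₀ (by norm_num) this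
    have hd' : l = 0 ∨ (11 ∣ (z + 7 * c) - 7 * (-c) ∧ ¬ 11 ∣ -c) := by
      rcases Nat.eq_zero_or_pos l with hl | hl
      · exact Or.inl hl
      refine Or.inr ?_
      have h₁ : (11 : ℤ) ∣ z * (z + 14 * c) := by
        have : (11 : ℤ) ∣ 11 ^ l := dvd_pow_self _ hl.ne'
        rw [← hnorm] at this
        have h₂ := this.sub (Dvd.intro (c ^ 2) rfl : (11 : ℤ) ∣ 11 * c ^ 2)
        ring_nf at h₂ ⊢
        exact h₂
      have h₃ := (Int.Prime.dvd_mul' (p := 11) (by norm_num) h₁).resolve_left hz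
      push_cast at h₃
      exact ⟨by ring_nf at h₃ ⊢; exact h₃, by omega⟩
    obtain ⟨u, hu⟩ := ih (z + 7 * c) (-c) (by rw [← hnorm]; ring) hd'
    refine ⟨u, ?_⟩
    rw [pow_succ, ← mul_assoc, ← hu]
    ext
    · simp [ofPair, Zsqrtd.re_mul]; ring
    · simp [ofPair, Zsqrtd.im_mul]; ring

theorem eq_zero_of_sq_eq_eleven_pow_add {y l i : ℕ} (hl : Odd l)
    (h : y ^ 2 = 11 ^ l + 38 * (19 ^ i) ^ 2) : i = 0 := by
  by_contra hi
  obtain ⟨i, rfl⟩ := Nat.exists_eq_succ_of_ne_zero hi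
  have hz : ¬ (11 : ℤ) ∣ 19 ^ (i + 1) := by
    intro hd
    have := Int.Prime.dvd_pow' (p := 11) (by norm_num) hd
    omega
  have hZ : (y : ℤ) ^ 2 = 11 ^ l + 38 * (19 ^ (i + 1)) ^ 2 := by exact_mod_cast h
  have hdvd : (11 : ℤ) ∣ ((y : ℤ) - 7 * 19 ^ (i + 1)) * (y + 7 * 19 ^ (i + 1)) := by
    have h₁ : (11 : ℤ) ∣ 11 ^ l := dvd_pow_self _ hl.pos.ne'
    have h₂ := h₁.sub (Dvd.intro ((19 ^ (i + 1)) ^ 2) rfl : (11 : ℤ) ∣ 11 * (19 ^ (i + 1)) ^ 2)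
    have : ((y : ℤ) - 7 * 19 ^ (i + 1)) * (y + 7 * 19 ^ (i + 1)) =
        11 ^ l - 11 * (19 ^ (i + 1)) ^ 2 := by linear_combination hZ
    rwa [this]
  have key : ∀ s : Bool, ¬ (11 : ℤ) ∣ y - 7 * ((bif s then -1 else 1) * 19 ^ (i + 1)) := by
    intro s hs
    obtain ⟨u, hu⟩ := exists_pell_mul_pow l y ((bif s then -1 else 1) * 19 ^ (i + 1))
      (by rw [hZ]; cases s <;> simp) (Or.inr ⟨hs, by cases s <;> simpa using hz⟩)
    obtain ⟨k, rfl | rfl⟩ := isFundamental_pell38.eq_zpow_or_neg_zpow u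
    · exact im_zpow_mul_pow_ne hl s (congrArg Zsqrtd.im hu).symm
    · refine im_zpow_mul_pow_ne (k := k) (i := i) hl (!s) ?_
      have := congrArg (fun x => -Zsqrtd.im x) hu
      have hneg : ((-pell38 ^ k : Pell.Solution₁ ((38 : ℕ) : ℤ)) : ℤ√((38 : ℕ) : ℤ)) =
        -((pell38 ^ k : Pell.Solution₁ ((38 : ℕ) : ℤ)) : ℤ√((38 : ℕ) : ℤ)) := rfl
      rw [hneg, neg_mul] at this
      simp only [Zsqrtd.im_neg, neg_neg] at this
      rw [← this]
      cases s <;> simp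
  rcases Int.Prime.dvd_mul' (p := 11) (by norm_num) hdvd with h₁ | h₁
  · exact key false (by simpa using h₁)
  · exact key true (by simpa using h₁)

theorem mulMod_powMod_of_121_dvd : ∀ n < 242,
    121 ∣ (mulMod 11 29161 (powMod 11 29161 (10, 3) 12 n) (7, 1)).2 →
      (mulMod 11 29161 (powMod 11 29161 (10, 3) 12 n) (7, 1)).2 = 6292 ∨
      (mulMod 11 29161 (powMod 11 29161 (10, 3) 12 n) (7, 1)).2 = 22869 := by
  decide +kernel

theorem mul_eleven_pow_mod_ne : ∀ j < 48, 121 * 11 ^ j % 29161 ≠ 6292 ∧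
    121 * 11 ^ j % 29161 ≠ 22869 := by
  decide +kernel

/-- The imaginary part of `(10 + 3√11) ^ k * (7 + √11)` is never `± 11 ^ (j + 2)`. -/
theorem im_zpow_mul_ne (k : ℤ) (j : ℕ) (s : Bool) :
    (((pell11 ^ k : Pell.Solution₁ ((11 : ℕ) : ℤ)) : ℤ√((11 : ℕ) : ℤ)) *
      ofPair 11 (7, 1)).im ≠ (bif s then -1 else 1) * 11 ^ (j + 2) := by
  intro him
  obtain ⟨n, hn⟩ := exists_redMod_zpow_eq_pow pell11 k 242 (by norm_num)
  have hε : (pell11 : ℤ√((11 : ℕ) : ℤ)) = ofPair 11 (10, 3) := rfl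
  have hone : redMod 11 29161 (ofPair 11 (10, 3)) ^ 242 = 1 :=
    redMod_pow_eq_one (by norm_num) (by decide +kernel)
  have hk := hn 29161 (by rw [hε]; exact hone)
  have hlt : n % 242 < 242 := Nat.mod_lt _ (by norm_num)
  rw [hε, pow_eq_pow_mod n hone, ← redMod_powMod 11 29161 12 (10, 3) _ (by omega)] at hk
  have hx := congrArg (· * redMod 11 29161 (ofPair 11 (7, 1))) hk
  rw [← map_mul, ← redMod_mulMod, redMod_eq_iff, him] at hx
  have h₂ := hx.2
  simp only [ofPair] at h₂
  have hr := mulMod_powMod_of_121_dvd _ hlt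
  have hrlt : (mulMod 11 29161 (powMod 11 29161 (10, 3) 12 (n % 242)) (7, 1)).2 < 29161 :=
    Nat.mod_lt _ (by norm_num)
  generalize (mulMod 11 29161 (powMod 11 29161 (10, 3) 12 (n % 242)) (7, 1)).2 = r at h₂ hr hrlt
  have hj : 121 * 11 ^ j % 29161 = 121 * 11 ^ (j % 48) % 29161 :=
    mul_pow_modEq_mul_pow_mod (N := 48) (by decide +kernel) j
  obtain ⟨h₃, h₄⟩ := mul_eleven_pow_mod_ne _ (Nat.mod_lt j (by norm_num))
  rw [← hj] at h₃ h₄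
  have hpow : (11 : ℤ) ^ (j + 2) = ((121 * 11 ^ j : ℕ) : ℤ) := by push_cast; ring
  rw [hpow] at h₂
  generalize hA : 11 ^ j = A at *
  have h₅ : (121 * A : ℤ) ≡ r [ZMOD 29161] ∨ (-(121 * A) : ℤ) ≡ r [ZMOD 29161] := by
    cases s
    · exact Or.inl (by simpa using h₂)
    · exact Or.inr (by simpa using h₂)
  have h121 : 121 ∣ r := by
    rcases h₅ with h₅ | h₅ <;> rw [Int.ModEq] at h₅ <;> omega
  rcases hr h121 with rfl | rfl <;> rcases h₅ with h₅ | h₅ <;> rw [Int.ModEq] at h₅ <;> omega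

theorem exists_pell_mul_of_norm_eq_38 {y w : ℤ} (h : y ^ 2 - 11 * w ^ 2 = 38)
    (hd : 19 ∣ y - 7 * w) : ∃ u : Pell.Solution₁ ((11 : ℕ) : ℤ),
      (⟨y, w⟩ : ℤ√((11 : ℕ) : ℤ)) = (u : ℤ√((11 : ℕ) : ℤ)) * ofPair 11 (7, 1) := by
  have h2 : (2 : ℤ) ∣ y - 7 * w := by
    have : (2 : ℤ) ∣ (y - 7 * w) * (y + 7 * w) := ⟨19 - 19 * w ^ 2, by linear_combination h⟩
    rcases Int.Prime.dvd_mul' (p := 2) (by norm_num) this with h' | h' <;> omega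
  obtain ⟨c, hc⟩ : (38 : ℤ) ∣ y - 7 * w := by omega
  obtain rfl : y = 7 * w + 38 * c := by linarith
  refine ⟨Pell.Solution₁.mk (w + 7 * c) (-c) (by push_cast; linarith), ?_⟩
  ext
  · simp [ofPair, Zsqrtd.re_mul]; ring
  · simp [ofPair, Zsqrtd.im_mul]; ring

theorem lt_two_of_sq_eq_mul_eleven_pow_add {y j : ℕ}
    (h : y ^ 2 = 11 * (11 ^ j) ^ 2 + 38) : j < 2 := by
  by_contra! hj
  obtain ⟨j, rfl⟩ := Nat.exists_eq_add_of_le' hj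
  have hZ : (y : ℤ) ^ 2 = 11 * (11 ^ (j + 2)) ^ 2 + 38 := by exact_mod_cast h
  have hdvd : (19 : ℤ) ∣ ((y : ℤ) - 7 * 11 ^ (j + 2)) * (y + 7 * 11 ^ (j + 2)) :=
    ⟨2 - 2 * (11 ^ (j + 2)) ^ 2, by linear_combination hZ⟩
  have key : ∀ s : Bool, ¬ (19 : ℤ) ∣ y - 7 * ((bif s then -1 else 1) * 11 ^ (j + 2)) := by
    intro s hs
    obtain ⟨u, hu⟩ := exists_pell_mul_of_norm_eq_38 (y := y)
      (w := (bif s then -1 else 1) * 11 ^ (j + 2)) (by rw [hZ]; cases s <;> simp) hs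
    obtain ⟨k, rfl | rfl⟩ := isFundamental_pell11.eq_zpow_or_neg_zpow u
    · exact im_zpow_mul_ne k j s (congrArg Zsqrtd.im hu).symm
    · refine im_zpow_mul_ne k j (!s) ?_
      have := congrArg (fun x => -Zsqrtd.im x) hu
      have hneg : ((-pell11 ^ k : Pell.Solution₁ ((11 : ℕ) : ℤ)) : ℤ√((11 : ℕ) : ℤ)) =
        -((pell11 ^ k : Pell.Solution₁ ((11 : ℕ) : ℤ)) : ℤ√((11 : ℕ) : ℤ)) := rfl
      rw [hneg, neg_mul] at this
      simp only [Zsqrtd.im_neg, neg_neg] at this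
      rw [← this]
      cases s <;> simp
  rcases Int.Prime.dvd_mul' (p := 19) (by norm_num) hdvd with h₁ | h₁
  · exact key false (by simpa using h₁)
  · exact key true (by simpa using h₁)

theorem sq_eq_eleven_pow_add_two_mul {y l m : ℕ} (hl : Odd l) (hm : Odd m)
    (h : y ^ 2 = 11 ^ l + 2 * 19 ^ m) : m = 1 ∧ (l = 1 ∨ l = 3) := by
  obtain ⟨i, rfl⟩ := hm
  obtain rfl : i = 0 := eq_zero_of_sq_eq_eleven_pow_add hl (by rw [h]; ring)
  obtain ⟨j, rfl⟩ := hl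
  have := lt_two_of_sq_eq_mul_eleven_pow_add (y := y) (j := j) (by rw [h]; ring)
  omega

theorem modEq_of_eq_of_modEq {a b c d Q : ℕ} (h : a = b) (h₁ : a ≡ c [MOD Q])
    (h₂ : b ≡ d [MOD Q]) : c ≡ d [MOD Q] :=
  h₁.symm.trans (h ▸ h₂)

theorem two_pow_cases {t : ℕ} (ht : 0 < t) : t = 1 ∨ t = 2 ∨ ∃ r, 2 ^ t = 8 * 2 ^ r := by
  rcases t with _ | _ | _ | r
  · omega
  · simp
  · simp
  · exact Or.inr (Or.inr ⟨r, by ring⟩)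

theorem eight_mul_two_pow_modEq (t : ℕ) : 8 * 2 ^ t ≡ 8 * 2 ^ (t % 4) [MOD 120] :=
  mul_pow_modEq_mul_pow_mod (by decide) t

theorem eleven_pow_modEq (l : ℕ) : 11 ^ l ≡ 11 ^ (l % 2) [MOD 120] :=
  pow_modEq_pow_mod (by decide) l

theorem nineteen_pow_modEq (m : ℕ) : 19 ^ m ≡ 19 ^ (m % 2) [MOD 120] :=
  pow_modEq_pow_mod (by decide) m

theorem two_pow_add_one_ne {t : ℕ} (l m : ℕ) (ht : 0 < t) : 2 ^ t + 1 ≠ 11 ^ l * 19 ^ m := by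
  intro h
  have hr := (eleven_pow_modEq l).mul (nineteen_pow_modEq m)
  have hl := Nat.mod_lt l two_pos
  have hm := Nat.mod_lt m two_pos
  rcases two_pow_cases ht with rfl | rfl | ⟨r, hr'⟩
  · have key : ∀ l < 2, ∀ m < 2, ¬ 2 ^ 1 + 1 ≡ 11 ^ l * 19 ^ m [MOD 120] := by decide
    exact key _ hl _ hm (modEq_of_eq_of_modEq h rfl hr)
  · have key : ∀ l < 2, ∀ m < 2, ¬ 2 ^ 2 + 1 ≡ 11 ^ l * 19 ^ m [MOD 120] := by decide
    exact key _ hl _ hm (modEq_of_eq_of_modEq h rfl hr)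
  · have key : ∀ r < 4, ∀ l < 2, ∀ m < 2, ¬ 8 * 2 ^ r + 1 ≡ 11 ^ l * 19 ^ m [MOD 120] := by decide
    rw [hr'] at h
    exact key _ (Nat.mod_lt r four_pos) _ hl _ hm
      (modEq_of_eq_of_modEq h ((eight_mul_two_pow_modEq r).add_right 1) hr)

theorem two_pow_eq_add_one {t l m : ℕ} (ht : 0 < t) (h : 2 ^ t = 11 ^ l * 19 ^ m + 1) :
    t = 1 ∧ l = 0 ∧ m = 0 := by
  have hr := ((eleven_pow_modEq l).mul (nineteen_pow_modEq m)).add_right 1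
  have hl := Nat.mod_lt l two_pos
  have hm := Nat.mod_lt m two_pos
  rcases two_pow_cases ht with rfl | rfl | ⟨r, hr'⟩
  · have : 11 ^ l * 19 ^ m = 1 := by omega
    simpa using this
  · have key : ∀ l < 2, ∀ m < 2, ¬ 2 ^ 2 ≡ 11 ^ l * 19 ^ m + 1 [MOD 120] := by decide
    exact absurd (modEq_of_eq_of_modEq h rfl hr) (key _ hl _ hm)
  · have key : ∀ r < 4, ∀ l < 2, ∀ m < 2, ¬ 8 * 2 ^ r ≡ 11 ^ l * 19 ^ m + 1 [MOD 120] := by decide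
    rw [hr'] at h
    exact absurd (modEq_of_eq_of_modEq h (eight_mul_two_pow_modEq r) hr)
      (key _ (Nat.mod_lt r four_pos) _ hl _ hm)

theorem two_pow_mul_eleven_pow_add_one_ne (t l m : ℕ) :
    2 ^ t * 11 ^ l + 1 ≠ 19 ^ m := by
  intro h
  have hl := Nat.mod_lt l two_pos
  have hm := Nat.mod_lt m two_pos
  have key : ∀ t < 2, ∀ l < 2, ∀ m < 2, ¬ 2 ^ t * 11 ^ l + 1 ≡ 19 ^ m [MOD 3] := by decide
  exact key _ (Nat.mod_lt t two_pos) _ hl _ hm (modEq_of_eq_of_modEq h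
    (((pow_modEq_pow_mod (by decide) t).mul (pow_modEq_pow_mod (by decide) l)).add_right 1)
    (pow_modEq_pow_mod (by decide) m))

theorem two_mul_sq_modEq_one_ne {p z : ℕ} (hp : p = 11 ∨ p = 19) : ¬ 2 * z ^ 2 ≡ 1 [MOD p] := by
  intro h
  have h₁ : 2 * (z % p) ^ 2 ≡ 1 [MOD p] := (((Nat.mod_modEq z p).pow 2).mul_left 2).trans h
  have key : ∀ p, p = 11 ∨ p = 19 → ∀ r < p, ¬ 2 * r ^ 2 ≡ 1 [MOD p] := by
    rintro p (rfl | rfl) <;> decide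
  exact key p hp _ (Nat.mod_lt _ (by omega)) h₁

theorem pow_modEq_zero {b n : ℕ} (hn : n ≠ 0) : b ^ n ≡ 0 [MOD b] :=
  Nat.modEq_zero_iff_dvd.2 (dvd_pow_self b hn)

theorem two_mul_pow_eq_pow_add_one {p q a b : ℕ} (hp : p = 11 ∨ p = 19) (ha : Even a)
    (hq : 1 < q) (h : 2 * q ^ a = p ^ b + 1) : a = 0 ∧ b = 0 := by
  have hb : b = 0 := by
    by_contra hb
    obtain ⟨c, rfl⟩ := ha.two_dvd
    refine two_mul_sq_modEq_one_ne (z := q ^ c) hp ?_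
    have e : 2 * (q ^ c) ^ 2 = p ^ b + 1 := by rw [← h]; ring
    rw [e]
    simpa using (pow_modEq_zero (b := p) hb).add_right 1
  subst hb
  rw [pow_zero] at h
  have : q ^ a = 1 := by omega
  exact ⟨by simpa [hq.ne'] using this, rfl⟩

theorem two_pow_mul_eleven_pow_eq {t l m : ℕ} (ht : 0 < t) (h : 2 ^ t * 11 ^ l = 19 ^ m + 1) :
    t = 1 ∧ l = 0 ∧ m = 0 := by
  have hr := (nineteen_pow_modEq m).add_right 1
  have hl := Nat.mod_lt l two_pos
  have hm := Nat.mod_lt m two_pos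
  rcases two_pow_cases ht with rfl | rfl | ⟨r, hr'⟩
  · have key : ∀ l < 2, ∀ m < 2, 2 ^ 1 * 11 ^ l ≡ 19 ^ m + 1 [MOD 120] → l = 0 := by decide
    have hl0 := key _ hl _ hm (modEq_of_eq_of_modEq h ((eleven_pow_modEq l).mul_left _) hr)
    exact ⟨rfl, two_mul_pow_eq_pow_add_one (q := 11) (Or.inr rfl) (Nat.even_iff.2 hl0) (by norm_num)
      (by simpa using h)⟩
  · have key : ∀ l < 2, ∀ m < 2, ¬ 2 ^ 2 * 11 ^ l ≡ 19 ^ m + 1 [MOD 120] := by decide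
    exact absurd (modEq_of_eq_of_modEq h ((eleven_pow_modEq l).mul_left _) hr) (key _ hl _ hm)
  · have key : ∀ r < 4, ∀ l < 2, ∀ m < 2, ¬ 8 * 2 ^ r * 11 ^ l ≡ 19 ^ m + 1 [MOD 120] := by decide
    rw [hr'] at h
    exact absurd (modEq_of_eq_of_modEq h
      ((eight_mul_two_pow_modEq r).mul (eleven_pow_modEq l)) hr)
      (key _ (Nat.mod_lt r four_pos) _ hl _ hm)

theorem two_pow_mul_nineteen_pow_add_one_ne (t l m : ℕ) :
    2 ^ t * 19 ^ m + 1 ≠ 11 ^ l := by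
  intro h
  have key : ∀ t < 4, ∀ m < 2, ¬ 2 ^ t * 19 ^ m + 1 ≡ 1 [MOD 5] := by decide
  refine key _ (Nat.mod_lt t four_pos) _ (Nat.mod_lt m two_pos) (modEq_of_eq_of_modEq h
    (((pow_modEq_pow_mod (by decide) t).mul (pow_modEq_pow_mod (by decide) m)).add_right 1) ?_)
  simpa using ((by decide : 11 ≡ 1 [MOD 5]).pow l)

theorem two_pow_mul_nineteen_pow_eq {t l m : ℕ} (ht : 0 < t) (h : 2 ^ t * 19 ^ m = 11 ^ l + 1) :
    t = 1 ∧ l = 0 ∧ m = 0 := by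
  have hr := (eleven_pow_modEq l).add_right 1
  have hl := Nat.mod_lt l two_pos
  have hm := Nat.mod_lt m two_pos
  rcases two_pow_cases ht with rfl | rfl | ⟨r, hr'⟩
  · have key : ∀ l < 2, ∀ m < 2, 2 ^ 1 * 19 ^ m ≡ 11 ^ l + 1 [MOD 120] → m = 0 := by decide
    have hm0 := key _ hl _ hm (modEq_of_eq_of_modEq h ((nineteen_pow_modEq m).mul_left _) hr)
    exact ⟨rfl, (two_mul_pow_eq_pow_add_one (q := 19) (Or.inl rfl) (Nat.even_iff.2 hm0)
      (by norm_num) (by simpa using h)).symm⟩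
  · have key : ∀ l < 2, ∀ m < 2, ¬ 2 ^ 2 * 19 ^ m ≡ 11 ^ l + 1 [MOD 120] := by decide
    exact absurd (modEq_of_eq_of_modEq h ((nineteen_pow_modEq m).mul_left _) hr) (key _ hl _ hm)
  · have key : ∀ r < 4, ∀ l < 2, ∀ m < 2, ¬ 8 * 2 ^ r * 19 ^ m ≡ 11 ^ l + 1 [MOD 120] := by decide
    rw [hr'] at h
    exact absurd (modEq_of_eq_of_modEq h
      ((eight_mul_two_pow_modEq r).mul (nineteen_pow_modEq m)) hr)
      (key _ (Nat.mod_lt r four_pos) _ hl _ hm)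

theorem two_pow_add_nineteen_pow_ne {t : ℕ} (l m : ℕ) (ht : 0 < t) :
    2 ^ t + 19 ^ m ≠ 11 ^ l := by
  intro h
  have hr := eleven_pow_modEq l
  have hl := Nat.mod_lt l two_pos
  have hm := Nat.mod_lt m two_pos
  rcases two_pow_cases ht with rfl | rfl | ⟨r, hr'⟩
  · have key : ∀ l < 2, ∀ m < 2, ¬ 2 ^ 1 + 19 ^ m ≡ 11 ^ l [MOD 120] := by decide
    exact key _ hl _ hm (modEq_of_eq_of_modEq h ((nineteen_pow_modEq m).add_left _) hr)
  · have key : ∀ l < 2, ∀ m < 2, ¬ 2 ^ 2 + 19 ^ m ≡ 11 ^ l [MOD 120] := by decide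
    exact key _ hl _ hm (modEq_of_eq_of_modEq h ((nineteen_pow_modEq m).add_left _) hr)
  · have key : ∀ r < 4, ∀ l < 2, ∀ m < 2, ¬ 8 * 2 ^ r + 19 ^ m ≡ 11 ^ l [MOD 120] := by decide
    rw [hr'] at h
    exact key _ (Nat.mod_lt r four_pos) _ hl _ hm (modEq_of_eq_of_modEq h
      ((eight_mul_two_pow_modEq r).add (nineteen_pow_modEq m)) hr)

theorem eleven_pow_add_nineteen_pow_eq {t l m : ℕ} (ht : 0 < t) (h : 11 ^ l + 19 ^ m = 2 ^ t) :
    t = 1 ∧ l = 0 ∧ m = 0 := by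
  have hr := (eleven_pow_modEq l).add (nineteen_pow_modEq m)
  have hl := Nat.mod_lt l two_pos
  have hm := Nat.mod_lt m two_pos
  rcases two_pow_cases ht with rfl | rfl | ⟨r, hr'⟩
  · have h₁ : 0 < 11 ^ l := by positivity
    have h₂ : 0 < 19 ^ m := by positivity
    have h₃ : 11 ^ l = 1 := by omega
    have h₄ : 19 ^ m = 1 := by omega
    exact ⟨rfl, by simpa using h₃, by simpa using h₄⟩
  · have key : ∀ l < 2, ∀ m < 2, ¬ 11 ^ l + 19 ^ m ≡ 2 ^ 2 [MOD 120] := by decide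
    exact absurd (modEq_of_eq_of_modEq h hr rfl) (key _ hl _ hm)
  · have key : ∀ r < 4, ∀ l < 2, ∀ m < 2, ¬ 11 ^ l + 19 ^ m ≡ 8 * 2 ^ r [MOD 120] := by decide
    rw [hr'] at h
    exact absurd (modEq_of_eq_of_modEq h hr (eight_mul_two_pow_modEq r))
      (key _ (Nat.mod_lt r four_pos) _ hl _ hm)

theorem sixteen_mul_two_pow_add_eleven_pow_ne (r l m : ℕ) : 16 * 2 ^ r + 11 ^ l ≠ 19 ^ m := by
  intro h
  have key : ∀ r < 12, ∀ l < 12, ∀ m < 12,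
      ¬ (16 * 2 ^ r + 11 ^ l) % 65520 = 19 ^ m % 65520 := by decide +kernel
  exact key _ (Nat.mod_lt r (by norm_num)) _ (Nat.mod_lt l (by norm_num)) _
    (Nat.mod_lt m (by norm_num)) (modEq_of_eq_of_modEq h
      ((mul_pow_modEq_mul_pow_mod (by decide +kernel) r).add
        (pow_modEq_pow_mod (by decide +kernel) l)) (pow_modEq_pow_mod (by decide +kernel) m))

theorem eight_add_mul_eleven_pow_ne (l m : ℕ) : 8 + 121 * 11 ^ l ≠ 19 ^ m := by
  intro h
  have key : ∀ l < 110, ∀ m < 110,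
      ¬ (8 + 121 * 11 ^ l) % 8349 = 19 ^ m % 8349 := by decide +kernel
  exact key _ (Nat.mod_lt l (by norm_num)) _ (Nat.mod_lt m (by norm_num))
    (modEq_of_eq_of_modEq h ((mul_pow_modEq_mul_pow_mod (by decide +kernel) l).add_left 8)
      (pow_modEq_pow_mod (by decide +kernel) m))

theorem two_pow_add_eleven_pow_eq {t l m : ℕ} (ht : 0 < t) (h : 2 ^ t + 11 ^ l = 19 ^ m) :
    t = 3 ∧ l = 1 ∧ m = 1 := by
  have hr := nineteen_pow_modEq m
  have hl := Nat.mod_lt l two_pos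
  have hm := Nat.mod_lt m two_pos
  have key : ∀ t < 3, 0 < t → ∀ l < 2, ∀ m < 2, ¬ 2 ^ t + 11 ^ l ≡ 19 ^ m [MOD 120] := by decide
  have ht₁ : ¬ t < 3 := fun ht' => key _ ht' ht _ hl _ hm
    (modEq_of_eq_of_modEq h ((eleven_pow_modEq l).add_left _) hr)
  have ht₂ : t < 4 := by
    by_contra! ht'
    obtain ⟨r, rfl⟩ := Nat.exists_eq_add_of_le' ht'
    exact sixteen_mul_two_pow_add_eleven_pow_ne r l m (by rw [← h]; ring)
  obtain rfl : t = 3 := by omega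
  have hl₂ : l < 2 := by
    by_contra! hl'
    obtain ⟨r, rfl⟩ := Nat.exists_eq_add_of_le' hl'
    exact eight_add_mul_eleven_pow_ne r m (by rw [← h]; ring)
  rcases m with _ | _ | m
  · interval_cases l <;> omega
  · interval_cases l <;> omega
  · have : 19 ^ 2 ≤ 19 ^ (m + 1 + 1) := Nat.pow_le_pow_right (by norm_num) (by omega)
    interval_cases l <;> omega

theorem exists_mul_eq_of_coprime {p n a b c : ℕ} (hp : p.Prime) (hab : a.Coprime b)
    (h : a * b = p ^ n * c) :
    (∃ d, a = p ^ n * d ∧ d.Coprime b ∧ d * b = c) ∨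
      ∃ d, b = p ^ n * d ∧ a.Coprime d ∧ a * d = c := by
  have hpos : 0 < p ^ n := pow_pos hp.pos n
  have hdvd : p ^ n ∣ a ∨ p ^ n ∣ b := by
    rcases eq_or_ne n 0 with rfl | hn
    · simp
    · exact (hab.isPrimePow_dvd_mul (hp.isPrimePow.pow hn)).1 ⟨c, h⟩
  rcases hdvd with ⟨d, rfl⟩ | ⟨d, rfl⟩
  · exact Or.inl ⟨d, rfl, hab.coprime_dvd_left (dvd_mul_left _ _),
      Nat.eq_of_mul_eq_mul_left hpos (by rw [← h]; ring)⟩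
  · exact Or.inr ⟨d, rfl, hab.coprime_dvd_right (dvd_mul_left _ _),
      Nat.eq_of_mul_eq_mul_left hpos (by rw [← h]; ring)⟩

theorem cases_of_coprime_mul_eq_pow_mul_pow {p q i j a b : ℕ} (hp : p.Prime) (hq : q.Prime)
    (hab : a.Coprime b) (h : a * b = p ^ i * q ^ j) :
    (a = 1 ∧ b = p ^ i * q ^ j) ∨ (a = p ^ i ∧ b = q ^ j) ∨ (a = q ^ j ∧ b = p ^ i) ∨
      (a = p ^ i * q ^ j ∧ b = 1) := by
  rcases exists_mul_eq_of_coprime hp hab h with ⟨c, rfl, hc, h₁⟩ | ⟨c, rfl, hc, h₁⟩ <;>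
  rcases exists_mul_eq_of_coprime (c := 1) hq hc (by rw [h₁, mul_one]) with
    ⟨d, rfl, -, h₂⟩ | ⟨d, rfl, -, h₂⟩ <;>
  obtain ⟨rfl, rfl⟩ := mul_eq_one.1 h₂ <;> simp

theorem cases_of_coprime_mul_eq {a b s l m : ℕ} (hab : a.Coprime b)
    (h : a * b = 2 ^ s * (11 ^ l * 19 ^ m)) :
    ((a = 1 ∧ b = 2 ^ s * (11 ^ l * 19 ^ m)) ∨ (a = 2 ^ s ∧ b = 11 ^ l * 19 ^ m) ∨
      (a = 11 ^ l ∧ b = 2 ^ s * 19 ^ m) ∨ (a = 19 ^ m ∧ b = 2 ^ s * 11 ^ l)) ∨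
    (b = 1 ∧ a = 2 ^ s * (11 ^ l * 19 ^ m)) ∨ (b = 2 ^ s ∧ a = 11 ^ l * 19 ^ m) ∨
      (b = 11 ^ l ∧ a = 2 ^ s * 19 ^ m) ∨ (b = 19 ^ m ∧ a = 2 ^ s * 11 ^ l) := by
  rcases exists_mul_eq_of_coprime Nat.prime_two hab h with ⟨c, rfl, hc, h₁⟩ | ⟨c, rfl, hc, h₁⟩ <;>
  rcases cases_of_coprime_mul_eq_pow_mul_pow (by norm_num) (by norm_num) hc h₁ with
    ⟨rfl, rfl⟩ | ⟨rfl, rfl⟩ | ⟨rfl, rfl⟩ | ⟨rfl, rfl⟩ <;> simp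

/-- Factoring `y ^ 2 - z ^ 2 = 2 ^ s * T` for coprime odd `z` and `T`. -/
theorem exists_factors_of_sq_add_eq_sq {z s T y : ℕ} (hz : Odd z) (hs : 0 < s)
    (hzT : z.Coprime T) (h : z ^ 2 + 2 ^ s * T = y ^ 2) (hT : Odd T) :
    ∃ t u v, 0 < t ∧ s = t + 2 ∧ u.Coprime v ∧ u + z = v ∧ u * v = 2 ^ t * T ∧ y = u + v := by
  have hyz : z ≤ y := by
    rw [← Nat.pow_le_pow_iff_left two_ne_zero]
    omega
  have hy : Odd y := by
    have : Odd (y ^ 2) := by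
      rw [← h]
      exact hz.pow.add_even ((even_two.pow_of_ne_zero hs.ne').mul_right T)
    exact Nat.Odd.of_mul_left (pow_two y ▸ this)
  obtain ⟨u, hu⟩ : ∃ u, y = z + 2 * u := by
    obtain ⟨a, rfl⟩ := hz
    obtain ⟨b, rfl⟩ := hy
    exact ⟨b - a, by omega⟩
  have huv : 4 * (u * (u + z)) = 2 ^ s * T := by
    rw [hu] at h
    linarith [h, (by ring : (z + 2 * u) ^ 2 = z ^ 2 + 4 * (u * (u + z)))]
  have h8 : 8 ∣ 2 ^ s * T := by
    obtain ⟨a, rfl⟩ := hz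
    have : Even (u * (u + (2 * a + 1))) := by
      rw [Nat.even_mul]
      rcases Nat.even_or_odd u with hu | hu
      · exact Or.inl hu
      · exact Or.inr (hu.add_odd (odd_two_mul_add_one a))
    obtain ⟨c, hc⟩ := this.two_dvd
    exact ⟨c, by omega⟩
  have hs₃ : 3 ≤ s := by
    have : 2 ^ 3 ∣ 2 ^ s :=
      (Nat.Coprime.pow_left 3 (Nat.coprime_two_left.2 hT)).dvd_of_dvd_mul_right h8
    exact (Nat.pow_dvd_pow_iff_le_right (by norm_num)).1 this
  obtain ⟨t, rfl⟩ : ∃ t, s = t + 2 := ⟨s - 2, by omega⟩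
  have huv' : u * (u + z) = 2 ^ t * T := by
    rw [pow_add] at huv
    linarith
  refine ⟨t, u, u + z, by omega, rfl, ?_, rfl, huv', by omega⟩
  have hzu : z.Coprime u := Nat.Coprime.coprime_dvd_right (Dvd.intro _ huv')
    (Nat.Coprime.mul_right (Nat.Coprime.pow_right _ (Nat.coprime_two_right.2 hz)) hzT)
  simpa using hzu.symm

theorem odd_eleven_pow (l : ℕ) : Odd (11 ^ l) := Odd.pow (by decide)

theorem odd_nineteen_pow (m : ℕ) : Odd (19 ^ m) := Odd.pow (by decide)

theorem one_add_eq_sq {s l m y : ℕ} (hs : 0 < s) (h : 1 + 2 ^ s * (11 ^ l * 19 ^ m) = y ^ 2) :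
    s = 3 ∧ l = 0 ∧ m = 0 := by
  obtain ⟨t, u, v, ht, rfl, huv, hadd, hmul, -⟩ := exists_factors_of_sq_add_eq_sq (z := 1)
    odd_one hs (Nat.coprime_one_left _) (by simpa using h)
    ((odd_eleven_pow l).mul (odd_nineteen_pow m))
  have hT : 0 < 11 ^ l * 19 ^ m := by positivity
  have h2 : 2 ≤ 2 ^ t := Nat.le_self_pow ht.ne' 2
  rcases cases_of_coprime_mul_eq huv hmul with
    (⟨rfl, rfl⟩ | ⟨rfl, rfl⟩ | ⟨rfl, rfl⟩ | ⟨rfl, rfl⟩) |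
      ⟨rfl, rfl⟩ | ⟨rfl, rfl⟩ | ⟨rfl, rfl⟩ | ⟨rfl, rfl⟩
  · have h1 : 11 ^ l * 19 ^ m = 1 := by nlinarith
    have h2 : 2 ^ t = 2 ^ 1 := by rw [h1] at hadd; omega
    have := Nat.pow_right_injective le_rfl h2
    simp at h1
    omega
  · exact absurd hadd (two_pow_add_one_ne l m ht)
  · obtain ⟨rfl, rfl, rfl⟩ := two_pow_mul_nineteen_pow_eq ht hadd.symm
    simp
  · obtain ⟨rfl, rfl, rfl⟩ := two_pow_mul_eleven_pow_eq ht hadd.symm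
    simp
  · have : 0 < 2 ^ t * (11 ^ l * 19 ^ m) := by positivity
    omega
  · obtain ⟨rfl, rfl, rfl⟩ := two_pow_eq_add_one ht hadd.symm
    simp
  · exact absurd hadd (two_pow_mul_nineteen_pow_add_one_ne t l m)
  · exact absurd hadd (two_pow_mul_eleven_pow_add_one_ne t l m)

theorem sq_modEq_sq_mod (y Q : ℕ) : y ^ 2 ≡ (y % Q) ^ 2 [MOD Q] :=
  ((Nat.mod_modEq y Q).pow 2).symm

theorem eleven_pow_add_eq_sq {s l m y : ℕ} (hs : 0 < s) (h : 11 ^ l + 2 ^ s * 19 ^ m = y ^ 2) :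
    s = 1 ∧ m = 1 ∧ (l = 1 ∨ l = 3) ∨ s = 5 ∧ m = 1 ∧ l = 2 ∨ s = 3 ∧ m = 0 ∧ l = 0 := by
  have hl := Nat.mod_lt l two_pos
  have hm := Nat.mod_lt m two_pos
  have hy := Nat.mod_lt y (by norm_num : 0 < 8)
  have hl8 : 11 ^ l ≡ 11 ^ (l % 2) [MOD 8] := pow_modEq_pow_mod (by decide) l
  have hm8 : 19 ^ m ≡ 19 ^ (m % 2) [MOD 8] := pow_modEq_pow_mod (by decide) m
  have hy8 := sq_modEq_sq_mod y 8
  rcases two_pow_cases hs with rfl | rfl | ⟨r, hr⟩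
  · have key : ∀ l < 2, ∀ m < 2, ∀ y < 8, 11 ^ l + 2 ^ 1 * 19 ^ m ≡ y ^ 2 [MOD 8] →
        l = 1 ∧ m = 1 := by decide
    have hlm := key _ hl _ hm _ hy (modEq_of_eq_of_modEq h (hl8.add (hm8.mul_left _)) hy8)
    exact Or.inl ⟨rfl, sq_eq_eleven_pow_add_two_mul (Nat.odd_iff.2 hlm.1) (Nat.odd_iff.2 hlm.2)
      (by simpa using h.symm)⟩
  · have key : ∀ l < 2, ∀ m < 2, ∀ y < 8, ¬ 11 ^ l + 2 ^ 2 * 19 ^ m ≡ y ^ 2 [MOD 8] := by decide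
    exact absurd (modEq_of_eq_of_modEq h (hl8.add (hm8.mul_left _)) hy8) (key _ hl _ hm _ hy)
  · have key : ∀ l < 2, ∀ y < 8, 11 ^ l + 0 ≡ y ^ 2 [MOD 8] → l = 0 := by decide
    have h0 : 2 ^ s * 19 ^ m ≡ 0 [MOD 8] := Nat.modEq_zero_iff_dvd.2 ⟨2 ^ r * 19 ^ m, by
      rw [hr, mul_assoc]⟩
    have hl0 := key _ hl _ hy (modEq_of_eq_of_modEq h (hl8.add h0) hy8)
    obtain ⟨i, rfl⟩ := (Nat.even_iff.2 hl0).two_dvd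
    obtain ⟨t, u, v, ht, rfl, huv, hadd, hmul, -⟩ := exists_factors_of_sq_add_eq_sq
      (z := 11 ^ i) (odd_eleven_pow i) hs (Nat.Coprime.pow _ _ (by norm_num))
      (by rw [← h]; ring) (odd_nineteen_pow m)
    rcases cases_of_coprime_mul_eq_pow_mul_pow Nat.prime_two (by norm_num) huv hmul with
      ⟨rfl, rfl⟩ | ⟨rfl, rfl⟩ | ⟨rfl, rfl⟩ | ⟨rfl, rfl⟩
    · obtain ⟨rfl, rfl, rfl⟩ := two_pow_mul_nineteen_pow_eq ht (hadd.symm.trans (add_comm _ _))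
      simp
    · obtain ⟨rfl, rfl, rfl⟩ := two_pow_add_eleven_pow_eq ht hadd
      simp
    · obtain ⟨rfl, rfl, rfl⟩ := eleven_pow_add_nineteen_pow_eq ht ((add_comm _ _).trans hadd)
      simp
    · have : 0 < 2 ^ t * 19 ^ m := by positivity
      have : 0 < 11 ^ i := by positivity
      omega

theorem even_of_nineteen_pow_add_eq_sq {s l m y : ℕ} (h : 19 ^ m + 2 ^ s * 11 ^ l = y ^ 2) :
    Even m := by
  rcases eq_or_ne l 0 with rfl | hl
  · rcases eq_or_ne m 0 with rfl | hm
    · exact Even.zero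
    rw [pow_zero, mul_one] at h
    have key₃ : ∀ s < 2, ∀ y < 3, 1 + 2 ^ s ≡ y ^ 2 [MOD 3] → s = 1 := by decide
    have hs : s % 2 = 1 := key₃ _ (Nat.mod_lt s two_pos) _ (Nat.mod_lt y three_pos)
      (modEq_of_eq_of_modEq h (((by decide : 19 ≡ 1 [MOD 3]).pow m).trans (by rw [one_pow]) |>.add
        (pow_modEq_pow_mod (by decide) s)) (sq_modEq_sq_mod y 3))
    have key : ∀ s < 18, ∀ y < 19, 0 + 2 ^ s ≡ y ^ 2 [MOD 19] → s % 2 = 0 := by decide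
    have := key _ (Nat.mod_lt s (by norm_num)) _ (Nat.mod_lt y (by norm_num))
      (modEq_of_eq_of_modEq h ((pow_modEq_zero hm).add (pow_modEq_pow_mod (by decide) s))
        (sq_modEq_sq_mod y 19))
    omega
  · have key : ∀ m < 10, ∀ y < 11, 19 ^ m + 0 ≡ y ^ 2 [MOD 11] → m % 2 = 0 := by decide
    have := key _ (Nat.mod_lt m (by norm_num)) _ (Nat.mod_lt y (by norm_num))
      (modEq_of_eq_of_modEq h ((pow_modEq_pow_mod (by decide) m).add
        ((pow_modEq_zero hl).mul_left (2 ^ s))) (sq_modEq_sq_mod y 11))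
    exact Nat.even_iff.2 (by omega)

theorem nineteen_pow_add_eq_sq {s l m y : ℕ} (hs : 0 < s) (h : 19 ^ m + 2 ^ s * 11 ^ l = y ^ 2) :
    s = 3 ∧ l = 0 ∧ m = 0 := by
  obtain ⟨i, rfl⟩ := (even_of_nineteen_pow_add_eq_sq h).two_dvd
  obtain ⟨t, u, v, ht, rfl, huv, hadd, hmul, -⟩ := exists_factors_of_sq_add_eq_sq
    (z := 19 ^ i) (odd_nineteen_pow i) hs (Nat.Coprime.pow _ _ (by norm_num))
    (by rw [← h]; ring) (odd_eleven_pow l)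
  rcases cases_of_coprime_mul_eq_pow_mul_pow Nat.prime_two (by norm_num) huv hmul with
    ⟨rfl, rfl⟩ | ⟨rfl, rfl⟩ | ⟨rfl, rfl⟩ | ⟨rfl, rfl⟩
  · obtain ⟨rfl, rfl, rfl⟩ := two_pow_mul_eleven_pow_eq ht (hadd.symm.trans (add_comm _ _))
    simp
  · exact absurd hadd (two_pow_add_nineteen_pow_ne l i ht)
  · obtain ⟨rfl, rfl, rfl⟩ := eleven_pow_add_nineteen_pow_eq ht hadd
    simp
  · have : 0 < 2 ^ t * 11 ^ l := by positivity
    have : 0 < 19 ^ i := by positivity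
    omega

theorem two_pow_add_eq_sq {s l m y : ℕ} (hs : 0 < s) (h : 2 ^ s + 11 ^ l * 19 ^ m = y ^ 2) :
    s = 4 ∧ l = 1 ∧ m = 1 ∨ s = 3 ∧ l = 0 ∧ m = 0 := by
  rcases Nat.even_or_odd s with hse | hso
  · obtain ⟨i, rfl⟩ := hse.two_dvd
    have hT : Odd (11 ^ l * 19 ^ m) := (odd_eleven_pow l).mul (odd_nineteen_pow m)
    have hiy : 2 ^ i ≤ y := by
      rw [← Nat.pow_le_pow_iff_left two_ne_zero, ← pow_mul, mul_comm i]
      omega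
    obtain ⟨u, rfl⟩ := Nat.exists_eq_add_of_le hiy
    have hmul : u * (u + 2 ^ (i + 1)) = 11 ^ l * 19 ^ m := by
      have e : (2 ^ i + u) ^ 2 = 2 ^ (2 * i) + u * (u + 2 ^ (i + 1)) := by ring
      omega
    have hu : Odd u := Nat.Odd.of_mul_left (hmul ▸ hT)
    have huv : u.Coprime (u + 2 ^ (i + 1)) := by
      simpa using Nat.Coprime.pow_right (i + 1) (Nat.coprime_two_right.2 hu)
    generalize hv : u + 2 ^ (i + 1) = v at hmul huv
    rw [add_comm] at hv
    rcases cases_of_coprime_mul_eq_pow_mul_pow (by norm_num) (by norm_num) huv hmul with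
      ⟨rfl, rfl⟩ | ⟨rfl, rfl⟩ | ⟨rfl, rfl⟩ | ⟨rfl, rfl⟩
    · exact absurd hv (two_pow_add_one_ne l m i.succ_pos)
    · obtain ⟨hi, rfl, rfl⟩ := two_pow_add_eleven_pow_eq i.succ_pos hv
      omega
    · exact absurd hv (two_pow_add_nineteen_pow_ne l m i.succ_pos)
    · have : 0 < 11 ^ l * 19 ^ m := by positivity
      have : 0 < 2 ^ (i + 1) := by positivity
      omega
  · have hs2 := Nat.odd_iff.1 hso
    have hl : l = 0 := by
      by_contra hl
      have key : ∀ s < 10, ∀ y < 11, 2 ^ s + 0 * 19 ^ m ≡ y ^ 2 [MOD 11] → s % 2 = 0 := by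
        rw [zero_mul]
        decide
      have := key _ (Nat.mod_lt s (by norm_num)) _ (Nat.mod_lt y (by norm_num))
        (modEq_of_eq_of_modEq h ((pow_modEq_pow_mod (by decide) s).add
          ((pow_modEq_zero hl).mul_right _)) (sq_modEq_sq_mod y 11))
      omega
    have hm : m = 0 := by
      by_contra hm
      have key : ∀ s < 18, ∀ y < 19, 2 ^ s + 11 ^ l * 0 ≡ y ^ 2 [MOD 19] → s % 2 = 0 := by
        rw [mul_zero]
        decide
      have := key _ (Nat.mod_lt s (by norm_num)) _ (Nat.mod_lt y (by norm_num))
        (modEq_of_eq_of_modEq h ((pow_modEq_pow_mod (by decide) s).add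
          ((pow_modEq_zero hm).mul_left _)) (sq_modEq_sq_mod y 19))
      omega
    subst hl hm
    exact Or.inr (one_add_eq_sq (l := 0) (m := 0) hs (by rw [← h]; ring))

theorem sq_add_ne_pow_four {x y l m : ℕ} (hx : 0 < x) (hgcd : x.Coprime y) :
    x ^ 2 + 11 ^ l * 19 ^ m ≠ y ^ 4 := by
  intro h
  have hT : Odd (11 ^ l * 19 ^ m) := (odd_eleven_pow l).mul (odd_nineteen_pow m)
  have hxy : x ≤ y ^ 2 := by
    rw [← Nat.pow_le_pow_iff_left two_ne_zero, ← pow_mul, ← h]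
    exact Nat.le_add_right _ _
  obtain ⟨a, ha⟩ := Nat.exists_eq_add_of_le' hxy
  have hmul : a * (a + 2 * x) = 11 ^ l * 19 ^ m := by
    have e : y ^ 4 = x ^ 2 + a * (a + 2 * x) := by
      rw [show y ^ 4 = (y ^ 2) ^ 2 by ring, ha]
      ring
    omega
  have hao : Odd a := Nat.Odd.of_mul_left (hmul ▸ hT)
  have hax : a.Coprime x := by
    have := (hgcd.pow_right 2).symm
    rw [ha] at this
    simpa using this
  have hab : a.Coprime (a + 2 * x) := by
    simpa using Nat.Coprime.mul_right (Nat.coprime_two_right.2 hao) hax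
  generalize hb : a + 2 * x = b at hmul hab
  have hsum : a + b = 2 * y ^ 2 := by omega
  have hone : 1 + 11 ^ l * 19 ^ m = 2 * y ^ 2 → l = 0 ∧ m = 0 := by
    intro h₁
    constructor
    · by_contra hl
      refine two_mul_sq_modEq_one_ne (p := 11) (z := y) (Or.inl rfl) ?_
      rw [← h₁]
      simpa using ((pow_modEq_zero (b := 11) hl).mul_right (19 ^ m)).add_left 1
    · by_contra hm
      refine two_mul_sq_modEq_one_ne (p := 19) (z := y) (Or.inr rfl) ?_
      rw [← h₁]
      simpa using ((pow_modEq_zero (b := 19) hm).mul_left (11 ^ l)).add_left 1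
  have htwo : 11 ^ l + 19 ^ m = 2 * y ^ 2 → l = 0 ∧ m = 0 := by
    intro h₁
    have hm : m = 0 := by
      by_contra hm
      have key : ∀ l < 3, ∀ y < 19, ¬ 11 ^ l + 0 ≡ 2 * y ^ 2 [MOD 19] := by decide
      exact key _ (Nat.mod_lt l (by norm_num)) _ (Nat.mod_lt y (by norm_num))
        (modEq_of_eq_of_modEq h₁ ((pow_modEq_pow_mod (by decide) l).add (pow_modEq_zero hm))
          ((sq_modEq_sq_mod y 19).mul_left 2))
    subst hm
    exact hone (by rw [← h₁]; ring)
  have hlm : l = 0 ∧ m = 0 := by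
    rcases cases_of_coprime_mul_eq_pow_mul_pow (by norm_num) (by norm_num) hab hmul with
      ⟨rfl, rfl⟩ | ⟨rfl, rfl⟩ | ⟨rfl, rfl⟩ | ⟨rfl, rfl⟩
    · exact hone hsum
    · exact htwo hsum
    · exact htwo ((add_comm _ _).trans hsum)
    · exact hone ((add_comm _ _).trans hsum)
  obtain ⟨rfl, rfl⟩ := hlm
  have := mul_eq_one.1 hmul
  omega

theorem eq_of_sq_add_eq_pow_four {x y k l m : ℕ} (hx : 0 < x) (hgcd : x.Coprime y)
    (h : x ^ 2 + 2 ^ k * (11 ^ l * 19 ^ m) = y ^ 4) :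
    x = 7 ∧ y ^ 2 = 3 ^ 2 ∧ k = 5 ∧ l = 0 ∧ m = 0 ∨
    x = 193 ∧ y ^ 2 = 15 ^ 2 ∧ k = 6 ∧ l = 1 ∧ m = 1 ∨
    x = 27 ∧ y ^ 2 = 7 ^ 2 ∧ k = 3 ∧ l = 1 ∧ m = 1 ∨
    x = 487 ∧ y ^ 2 = 27 ^ 2 ∧ k = 7 ∧ l = 2 ∧ m = 1 ∨
    x = 1293 ∧ y ^ 2 = 37 ^ 2 ∧ k = 3 ∧ l = 3 ∧ m = 1 := by
  rcases Nat.eq_zero_or_pos k with rfl | hk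
  · exact absurd (by simpa using h) (sq_add_ne_pow_four (l := l) (m := m) hx hgcd)
  have hxT : x.Coprime (2 ^ k * (11 ^ l * 19 ^ m)) := by
    have := hgcd.pow_right 4
    rw [← h] at this
    simpa [pow_two] using this
  have hxo : Odd x := Nat.coprime_two_right.1
    (hxT.coprime_dvd_right ((dvd_pow_self 2 hk.ne').mul_right _))
  obtain ⟨t, u, v, ht, rfl, huv, hadd, hmul, hy⟩ := exists_factors_of_sq_add_eq_sq
    (y := y ^ 2) hxo hk (hxT.coprime_dvd_right (dvd_mul_left _ _)) (by rw [h]; ring)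
    ((odd_eleven_pow l).mul (odd_nineteen_pow m))
  rcases cases_of_coprime_mul_eq huv hmul with
    (⟨rfl, rfl⟩ | ⟨rfl, rfl⟩ | ⟨rfl, rfl⟩ | ⟨rfl, rfl⟩) |
      ⟨rfl, rfl⟩ | ⟨rfl, rfl⟩ | ⟨rfl, rfl⟩ | ⟨rfl, rfl⟩
  · obtain ⟨rfl, rfl, rfl⟩ := one_add_eq_sq ht hy.symm
    omega
  · rcases two_pow_add_eq_sq ht hy.symm with ⟨rfl, rfl, rfl⟩ | ⟨rfl, rfl, rfl⟩ <;> omega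
  · rcases eleven_pow_add_eq_sq ht hy.symm with
      ⟨rfl, rfl, rfl | rfl⟩ | ⟨rfl, rfl, rfl⟩ | ⟨rfl, rfl, rfl⟩ <;> omega
  · obtain ⟨rfl, rfl, rfl⟩ := nineteen_pow_add_eq_sq ht hy.symm
    omega
  · obtain ⟨rfl, rfl, rfl⟩ := one_add_eq_sq ht ((add_comm _ _).trans hy.symm)
    omega
  · rcases two_pow_add_eq_sq ht ((add_comm _ _).trans hy.symm) with
      ⟨rfl, rfl, rfl⟩ | ⟨rfl, rfl, rfl⟩ <;> omega
  · rcases eleven_pow_add_eq_sq ht ((add_comm _ _).trans hy.symm) with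
      ⟨rfl, rfl, rfl | rfl⟩ | ⟨rfl, rfl, rfl⟩ | ⟨rfl, rfl, rfl⟩ <;> omega
  · obtain ⟨rfl, rfl, rfl⟩ := nineteen_pow_add_eq_sq ht ((add_comm _ _).trans hy.symm)
    omega

theorem stmt_3 (x y k l m : ℕ) (hx : 0 < x) (hy : 0 < y)
    (hgcd : Nat.gcd x y = 1) :
    x ^ 2 + 2 ^ k * 11 ^ l * 19 ^ m = y ^ 4 ↔
      (x, y, k, l, m) ∈ ({(7, 3, 5, 0, 0), (193, 15, 6, 1, 1),
        (27, 7, 3, 1, 1), (487, 27, 7, 2, 1),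
        (1293, 37, 3, 3, 1)} : Set (ℕ × ℕ × ℕ × ℕ × ℕ)) := by
  simp only [Set.mem_insert_iff, Set.mem_singleton_iff, Prod.mk.injEq]
  constructor
  · intro h
    simpa only [Nat.pow_left_inj two_ne_zero] using
      eq_of_sq_add_eq_pow_four hx hgcd (by rw [← h, mul_assoc])
  · rintro (⟨rfl, rfl, rfl, rfl, rfl⟩ | ⟨rfl, rfl, rfl, rfl, rfl⟩ | ⟨rfl, rfl, rfl, rfl, rfl⟩ |
      ⟨rfl, rfl, rfl, rfl, rfl⟩ | ⟨rfl, rfl, rfl, rfl, rfl⟩) <;> norm_num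
end

section
/- The only solution of x² + 2^k·11^ℓ·19^m = 55⁵ in a positive integer x and non-negative integers k, ℓ, m is (x, k, ℓ, m) = (22434, 0, 0, 1). -/
/-- Among the exponents small enough to contribute, `55 ^ 5 - 2 ^ k * 11 ^ l * 19 ^ m` is a
perfect square only for `(k, l, m) = (0, 0, 1)`. -/
theorem exponents_eq_of_sqrt_sq_add_eq :
    ∀ k ∈ Finset.range 29, ∀ l ∈ Finset.range 9, ∀ m ∈ Finset.range 7,
    Nat.sqrt (55 ^ 5 - 2 ^ k * 11 ^ l * 19 ^ m) ^ 2 + 2 ^ k * 11 ^ l * 19 ^ m = 55 ^ 5 →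
      k = 0 ∧ l = 0 ∧ m = 1 := by
  decide +kernel

theorem stmt_6 (x k l m : ℕ) (hx : 0 < x) :
    x ^ 2 + 2 ^ k * 11 ^ l * 19 ^ m = 55 ^ 5 ↔
      (x, k, l, m) = (22434, 0, 0, 1) := by
  constructor
  · intro h
    have hle {d : ℕ} (hd : d ∣ 2 ^ k * 11 ^ l * 19 ^ m) : d ≤ 55 ^ 5 :=
      (Nat.le_of_dvd (by positivity) hd).trans (by lia)
    have hk : k < 29 := (Nat.pow_lt_pow_iff_right (a := 2) (by norm_num)).1 <|
      (hle ((dvd_mul_right _ _).mul_right _)).trans_lt (by norm_num)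
    have hl : l < 9 := (Nat.pow_lt_pow_iff_right (a := 11) (by norm_num)).1 <|
      (hle ((dvd_mul_left _ _).mul_right _)).trans_lt (by norm_num)
    have hm : m < 7 := (Nat.pow_lt_pow_iff_right (a := 19) (by norm_num)).1 <|
      (hle (dvd_mul_left _ _)).trans_lt (by norm_num)
    have hsqrt : Nat.sqrt (55 ^ 5 - 2 ^ k * 11 ^ l * 19 ^ m) = x := by
      rw [← h, Nat.add_sub_cancel, Nat.sqrt_eq']
    obtain ⟨rfl, rfl, rfl⟩ :=
      exponents_eq_of_sqrt_sq_add_eq k (Finset.mem_range.2 hk) l (Finset.mem_range.2 hl) m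
        (Finset.mem_range.2 hm) (by rw [hsqrt, h])
    have hx_eq : x = 22434 := by nlinarith
    rw [hx_eq]
  · intro h
    simp only [Prod.mk.injEq] at h
    obtain ⟨rfl, rfl, rfl, rfl⟩ := h
    norm_num
end

section
/- The equation x² + 2^k·11^ℓ·19^m = 5⁷ has no solution in a positive integer x and non-negative integers k, ℓ, m. -/
/-- No `5 ^ 7 - x ^ 2` with `0 < x < 280` divides the largest admissible `2 ^ k * 11 ^ l * 19 ^ m`. -/
theorem not_five_pow_seven_sub_sq_dvd : ∀ x < 280, 0 < x →
    ¬5 ^ 7 - x ^ 2 ∣ 2 ^ 16 * 11 ^ 4 * 19 ^ 3 := by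
  decide +kernel

theorem stmt_7 : ¬∃ (x k l m : ℕ), 0 < x ∧
    x ^ 2 + 2 ^ k * 11 ^ l * 19 ^ m = 5 ^ 7 := by
  rintro ⟨x, k, l, m, hx, h⟩
  have hle : 2 ^ k * 11 ^ l * 19 ^ m ≤ 5 ^ 7 := h ▸ Nat.le_add_left _ _
  have hne : 2 ^ k * 11 ^ l * 19 ^ m ≠ 0 := by positivity
  have bound {a : ℕ} (ha : a ∣ 2 ^ k * 11 ^ l * 19 ^ m) : a ≤ 5 ^ 7 :=
    (Nat.le_of_dvd (Nat.pos_of_ne_zero hne) ha).trans hle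
  have hk : k < 17 := (Nat.pow_lt_pow_iff_right (by norm_num : 1 < 2)).mp <|
    (bound ((dvd_mul_right _ _).mul_right _)).trans_lt (by norm_num)
  have hl : l < 5 := (Nat.pow_lt_pow_iff_right (by norm_num : 1 < 11)).mp <|
    (bound ((dvd_mul_left _ _).mul_right _)).trans_lt (by norm_num)
  have hm : m < 4 := (Nat.pow_lt_pow_iff_right (by norm_num : 1 < 19)).mp <|
    (bound (dvd_mul_left _ _)).trans_lt (by norm_num)
  have hx' : x < 280 := lt_of_pow_lt_pow_left₀ 2 (by norm_num) <|
    (h ▸ Nat.le_add_right _ _ : x ^ 2 ≤ 5 ^ 7).trans_lt (by norm_num)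
  refine not_five_pow_seven_sub_sq_dvd x hx' hx ?_
  rw [← h, Nat.add_sub_cancel_left]
  exact mul_dvd_mul (mul_dvd_mul (pow_dvd_pow 2 (Nat.le_of_lt_succ hk))
    (pow_dvd_pow 11 (Nat.le_of_lt_succ hl))) (pow_dvd_pow 19 (Nat.le_of_lt_succ hm))
end

section
/- The only integer solutions of the equation 5u⁴ − 10u² + 1 = w² are those with u = 0 and w² = 1. -/
/-- Cassini's identity, in terms of two consecutive Fibonacci numbers. -/
lemma fib_cassini (n : ℕ) :
    (Nat.fib (n + 1) : ℤ) ^ 2 - Nat.fib n * Nat.fib (n + 1) - (Nat.fib n : ℤ) ^ 2 = (-1) ^ n := by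
  induction n with
  | zero => simp
  | succ n ih =>
    rw [Nat.fib_add_two]
    push_cast
    linear_combination -ih

/-- Nonnegative solutions of `v ^ 2 - a * v - a ^ 2 = 1` are consecutive Fibonacci numbers. -/
lemma exists_fib_of_sq_sub_mul_sub_sq_eq_one (n : ℕ) : ∀ a v : ℤ, a ≤ n → 0 ≤ a → 0 < v →
    v ^ 2 - a * v - a ^ 2 = 1 → ∃ k : ℕ, a = Nat.fib (2 * k) ∧ v = Nat.fib (2 * k + 1) := by
  induction n with
  | zero =>
    intro a v ha ha' hv h
    obtain rfl : a = 0 := by simp at ha; omega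
    refine ⟨0, by simp, ?_⟩
    simp only [mul_zero, zero_add, Nat.fib_one, Nat.cast_one]
    nlinarith
  | succ n ih =>
    intro a v ha ha' hv h
    rcases ha'.eq_or_lt with rfl | ha0
    · exact ih 0 v (by positivity) le_rfl hv h
    have h1 : a < v := by nlinarith
    have h2 : v ≤ 2 * a := by
      by_contra! h3
      nlinarith
    obtain ⟨k, hk, hk'⟩ := ih (2 * a - v) (v - a) (by push_cast at ha; omega) (by omega)
      (by omega) (by linear_combination h)
    have e1 := Nat.fib_add_two (n := 2 * k)
    have e2 : Nat.fib (2 * k + 1 + 2) = Nat.fib (2 * k + 1) + Nat.fib (2 * k + 2) := Nat.fib_add_two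
    refine ⟨k + 1, ?_, ?_⟩
    · rw [show 2 * (k + 1) = 2 * k + 2 by ring]
      omega
    · rw [show 2 * (k + 1) + 1 = 2 * k + 1 + 2 by ring]
      omega

lemma sq_ne_sq_add_two (r m : ℤ) : r ^ 2 ≠ m ^ 2 + 2 := by
  intro h
  have h4 : (r : ZMod 4) ^ 2 = (m : ZMod 4) ^ 2 + 2 := by exact_mod_cast congrArg _ h
  generalize (r : ZMod 4) = x at h4
  generalize (m : ZMod 4) = y at h4
  revert x y
  decide

/-- If a product of coprime factors is a square, its nonnegative second factor does not differ
by two from a square. -/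
lemma not_sq_add_or_sub_two_of_isCoprime {x y c : ℤ} (hxy : IsCoprime x y) (hc : x * y = c ^ 2)
    (hy : 0 ≤ y) (m : ℤ) : y ≠ m ^ 2 + 2 ∧ m ^ 2 ≠ y + 2 := by
  obtain ⟨r, hr⟩ := Int.sq_of_isCoprime hxy.symm (by rw [mul_comm, hc])
  have hr : y = r ^ 2 := by
    rcases hr with hr | hr
    · exact hr
    · nlinarith [sq_nonneg r]
  subst hr
  exact ⟨sq_ne_sq_add_two r m, sq_ne_sq_add_two m r⟩

/-- An odd-indexed Fibonacci number plus one is never a square. -/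
lemma fib_two_mul_add_one_add_one_ne_sq (k : ℕ) (u : ℤ) :
    (Nat.fib (2 * k + 1) : ℤ) + 1 ≠ u ^ 2 := by
  intro h
  rw [Nat.fib_two_mul_add_one] at h
  have hk := fib_cassini k
  rcases Nat.even_or_odd' k with ⟨j, rfl | rfl⟩
  · have e0 : (Nat.fib (2 * j + 1) : ℤ) = Nat.fib (j + 1) ^ 2 + Nat.fib j ^ 2 := by
      exact_mod_cast Nat.fib_two_mul_add_one j
    have e1 := Nat.fib_two_mul_add_two j
    have e2 := Nat.fib_add_two (n := 2 * j)
    have hj := fib_cassini j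
    zify at e1 e2
    push_cast at h
    rw [pow_mul, neg_one_sq, one_pow] at hk
    set p := (Nat.fib (2 * j) : ℤ)
    set q := (Nat.fib (2 * j + 1) : ℤ)
    set s := (Nat.fib j : ℤ)
    set t := (Nat.fib (j + 1) : ℤ)
    have hL : 2 * q - p = 3 * s ^ 2 + 2 * t ^ 2 - 2 * s * t := by
      linear_combination 3 * e0 + e2 - e1
    have := not_sq_add_or_sub_two_of_isCoprime (x := q) (y := 2 * q - p) (c := u)
      ⟨q - 3 * p, p, by linear_combination hk⟩ (by linear_combination h + hk)
      (by nlinarith [sq_nonneg (s - t), sq_nonneg s, sq_nonneg t]) (2 * t - s)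
    rcases neg_one_pow_eq_or ℤ j with hs | hs <;> rw [hs] at hj
    · exact this.2 (by linear_combination 2 * hj - hL)
    · exact this.1 (by linear_combination hL - 2 * hj)
  · have e0 : (Nat.fib (2 * j + 1) : ℤ) = Nat.fib (j + 1) ^ 2 + Nat.fib j ^ 2 := by
      exact_mod_cast Nat.fib_two_mul_add_one j
    have e1 := Nat.fib_two_mul_add_two j
    have hj := fib_cassini j
    zify at e1
    push_cast at h
    rw [(odd_two_mul_add_one j).neg_one_pow] at hk
    rw [show 2 * j + 1 + 1 = 2 * j + 2 by ring] at h hk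
    set p := (Nat.fib (2 * j + 1) : ℤ)
    set q := (Nat.fib (2 * j + 2) : ℤ)
    set s := (Nat.fib j : ℤ)
    set t := (Nat.fib (j + 1) : ℤ)
    have hL : 2 * p + q = 2 * s ^ 2 + 3 * t ^ 2 + 2 * s * t := by
      linear_combination 2 * e0 + e1
    have := not_sq_add_or_sub_two_of_isCoprime (x := p) (y := 2 * p + q) (c := u)
      ⟨p + q + 2 * q, -q, by linear_combination -hk⟩ (by linear_combination h - hk)
      (by positivity) (2 * s + t)
    rcases neg_one_pow_eq_or ℤ j with hs | hs <;> rw [hs] at hj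
    · exact this.1 (by linear_combination hL + 2 * hj)
    · exact this.2 (by linear_combination -hL - 2 * hj)

theorem stmt_12 (u w : ℤ) (h : 5 * u ^ 4 - 10 * u ^ 2 + 1 = w ^ 2) :
    u = 0 ∧ w ^ 2 = 1 := by
  by_cases hu : u = 0
  · subst hu
    exact ⟨rfl, by linarith⟩
  exfalso
  have hu1 : 0 < u ^ 2 := by positivity
  have hv : 0 < u ^ 2 - 1 := by
    by_contra! hv
    have : u ^ 2 = 1 := by omega
    nlinarith [sq_nonneg w]
  set v := u ^ 2 - 1 with hv_def
  have h5 : |w| ^ 2 + 4 = 5 * v ^ 2 := by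
    rw [sq_abs, hv_def]
    linear_combination -h
  have hw : v ≤ |w| := by
    by_contra! hw
    nlinarith [abs_nonneg w]
  have hpar : Even (|w| - v) := by
    have := congrArg (Even ·) h5
    simp only [Int.even_add, Int.even_mul, Int.even_pow, eq_iff_iff] at this
    rw [Int.even_sub]
    have h4 : Even (4 : ℤ) := by decide
    have h5' : ¬ Even (5 : ℤ) := by decide
    tauto
  obtain ⟨a, ha⟩ := hpar
  have hwa : |w| = 2 * a + v := by omega
  rw [hwa] at h5
  obtain ⟨k, -, hk⟩ := exists_fib_of_sq_sub_mul_sub_sq_eq_one a.toNat a v (by omega) (by omega) hv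
    (by linarith)
  exact fib_two_mul_add_one_add_one_ne_sq k u (by rw [← hk, hv_def]; ring)
end

section
/- There are no integers u and non-negative integers a, b satisfying 5u⁴ − 10u² + 1 = 209·(11^a·19^b)². -/
theorem stmt_13 : ¬∃ (u : ℤ) (a b : ℕ),
    5 * u ^ 4 - 10 * u ^ 2 + 1 = 209 * ((11 : ℤ) ^ a * 19 ^ b) ^ 2 := by
  rintro ⟨u, a, b, h⟩
  have h11 : (11 : ℤ) ^ (a * 2) ≡ 1 [ZMOD 5] := by
    simpa using (show (11 : ℤ) ≡ 1 [ZMOD 5] by decide).pow (a * 2)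
  have h19 : ((19 : ℤ) ^ 2) ^ b ≡ 1 [ZMOD 5] := by
    simpa using (show (19 : ℤ) ^ 2 ≡ 1 [ZMOD 5] by decide).pow b
  have hsq : ((11 : ℤ) ^ a * 19 ^ b) ^ 2 ≡ 1 [ZMOD 5] := by
    rw [mul_pow, ← pow_mul, pow_right_comm]
    simpa using h11.mul h19
  unfold Int.ModEq at hsq
  omega
end

section
/- Let u be an odd integer and let a ≥ 1, b ≥ 0, c ≥ 0 be integers such that 5u⁴ − 10u²·(2^a)² + (2^a)⁴ = −11^b·19^c. Then u² = 1, a = 1, b = 0 and c = 1. -/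
theorem quartic_ne_zero_zmod_eleven :
    ∀ x y : ZMod 11, y ≠ 0 → 5 * x ^ 4 - 10 * x ^ 2 * y ^ 2 + y ^ 4 ≠ 0 := by
  decide +kernel

theorem quartic_sq_ne_zmod_seventeen :
    ∀ x y : ZMod 17, y ^ 8 = 1 → (5 * x ^ 4 - 10 * x ^ 2 * y ^ 2 + y ^ 4) ^ 2 ≠ 64 := by
  decide +kernel

theorem quartic_ne_of_mod_four_eq_three (u : ℤ) (a c : ℕ) (hc : c % 4 = 3) :
    5 * u ^ 4 - 10 * u ^ 2 * ((2 : ℤ) ^ a) ^ 2 + ((2 : ℤ) ^ a) ^ 4 ≠ -(19 : ℤ) ^ c := by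
  intro h
  have h17 := congrArg (Int.cast : ℤ → ZMod 17) h
  push_cast at h17
  refine quartic_sq_ne_zmod_seventeen u (2 ^ a) ?_ ?_
  · rw [pow_right_comm, show (2 : ZMod 17) ^ 8 = 1 by decide, one_pow]
  · obtain ⟨k, rfl⟩ : ∃ k, c = 4 * k + 3 := ⟨c / 4, by omega⟩
    rw [h17, neg_sq, ← pow_mul, show (4 * k + 3) * 2 = 8 * k + 6 by ring, pow_add, pow_mul,
      show (19 : ZMod 17) ^ 8 = 1 by decide, one_pow]
    decide

theorem mod_four_eq_three_of_quartic_eq (u : ℤ) (hu : Odd u) (a c : ℕ) (ha : 2 ≤ a)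
    (h : 5 * u ^ 4 - 10 * u ^ 2 * ((2 : ℤ) ^ a) ^ 2 + ((2 : ℤ) ^ a) ^ 4 = -(19 : ℤ) ^ c) :
    c % 4 = 3 := by
  obtain ⟨d, rfl⟩ := Nat.exists_eq_add_of_le ha
  obtain ⟨k, rfl⟩ := hu
  have h16 := congrArg (Int.cast : ℤ → ZMod 16) h
  push_cast at h16
  have key : ∀ x y : ZMod 16, 5 * (2 * x + 1) ^ 4 - 10 * (2 * x + 1) ^ 2 * (2 ^ 2 * y) ^ 2
      + (2 ^ 2 * y) ^ 4 = 5 := by decide +kernel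
  rw [pow_add, key, ← Nat.div_add_mod c 4, pow_add, pow_mul,
    show (19 : ZMod 16) ^ 4 = 1 by decide, one_pow, one_mul] at h16
  have : c % 4 < 4 := Nat.mod_lt _ (by norm_num)
  generalize c % 4 = r at h16 this ⊢
  revert h16
  interval_cases r <;> decide

theorem sq_eq_one_of_quartic_two_eq (u : ℤ) (c : ℕ)
    (h : 5 * u ^ 4 - 10 * u ^ 2 * (2 : ℤ) ^ 2 + (2 : ℤ) ^ 4 = -(19 : ℤ) ^ c) :
    u ^ 2 = 1 ∧ c = 1 := by
  have hc : c < 2 := by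
    by_contra! hc
    have := pow_le_pow_right₀ (by norm_num : (1 : ℤ) ≤ 19) hc
    nlinarith [sq_nonneg (u ^ 2 - 4)]
  interval_cases c
  · omega
  · have hprod : (u ^ 2 - 1) * (u ^ 2 - 7) = 0 := by linarith
    rcases mul_eq_zero.mp hprod with h1 | h7
    · exact ⟨by linarith, rfl⟩
    · have : u < 3 := by nlinarith
      have : -3 < u := by nlinarith
      interval_cases u <;> omega

theorem stmt_14 (u : ℤ) (hu : Odd u) (a b c : ℕ) (ha : 1 ≤ a)
    (h : 5 * u ^ 4 - 10 * u ^ 2 * ((2 : ℤ) ^ a) ^ 2 + ((2 : ℤ) ^ a) ^ 4 =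
      -((11 : ℤ) ^ b * 19 ^ c)) :
    u ^ 2 = 1 ∧ a = 1 ∧ b = 0 ∧ c = 1 := by
  have hb : b = 0 := by
    by_contra hb
    have h11 := congrArg (Int.cast : ℤ → ZMod 11) h
    push_cast at h11
    have h2 : (2 : ZMod 11) ≠ 0 := by decide
    have h0 : (11 : ZMod 11) = 0 := by decide
    have : Fact (Nat.Prime 11) := ⟨by norm_num⟩
    refine quartic_ne_zero_zmod_eleven u (2 ^ a) (pow_ne_zero a h2) ?_
    rw [h11, h0, zero_pow hb, zero_mul, neg_zero]
  subst hb
  rw [pow_zero, one_mul] at h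
  obtain rfl | ha2 : a = 1 ∨ 2 ≤ a := by omega
  · rw [pow_one] at h
    obtain ⟨hu1, hc⟩ := sq_eq_one_of_quartic_two_eq u c h
    exact ⟨hu1, rfl, rfl, hc⟩
  · exact absurd h (quartic_ne_of_mod_four_eq_three u a c
      (mod_four_eq_three_of_quartic_eq u hu a c ha2 h))
end

section
/- Let u be an odd integer and v an integer of the form v = ±2^a·19^e with a, e ≥ 0, with gcd(u, v) = 1, and let b, c ≥ 0 be integers such that 5u⁴ − 20u²v² + 4v⁴ = −11^b·19^c. Then u² = 1, v² ∈ {1, 4}, b = 1 and c = 0. -/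
/-- The Lehmer numbers of odd index attached to `(√5 + √-11) / 2`. -/
def lehmerZ : ℕ → ℤ
  | 0 => 1
  | 1 => 1
  | n + 2 => -3 * lehmerZ (n + 1) - 16 * lehmerZ n

/-- The companion sequence of `lehmerZ`. -/
def lehmerW : ℕ → ℤ
  | 0 => 1
  | 1 => -7
  | n + 2 => -3 * lehmerW (n + 1) - 16 * lehmerW n

theorem lehmer_step (n : ℕ) :
    2 * lehmerW (n + 1) = -3 * lehmerW n - 11 * lehmerZ n ∧
      2 * lehmerZ (n + 1) = 5 * lehmerW n - 3 * lehmerZ n := by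
  induction n with
  | zero => simp [lehmerW, lehmerZ]
  | succ n ih =>
    simp only [lehmerW, lehmerZ]
    constructor <;> omega

theorem odd_lehmerZ (n : ℕ) : Odd (lehmerZ n) ∧ Odd (lehmerZ (n + 1)) := by
  induction n with
  | zero => simp [lehmerZ]
  | succ n ih =>
    refine ⟨ih.2, ?_⟩
    obtain ⟨k, hk⟩ := ih.2
    exact ⟨-3 * k - 2 - 8 * lehmerZ n, by simp only [lehmerZ]; omega⟩

theorem lehmerW_sub_lehmerZ (n : ℕ) : (8 : ℤ) ∣ lehmerW n - lehmerZ n := by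
  induction n with
  | zero => simp [lehmerW, lehmerZ]
  | succ n ih =>
    have := lehmer_step n
    omega

theorem exists_descent {w z N : ℤ} (hw : Odd w)
    (hN : 5 * w ^ 2 + 11 * z ^ 2 = 16 * (16 * N)) (hdvd : 32 ∣ 11 * z - 3 * w) :
    ∃ w' z' : ℤ, Odd w' ∧ Odd z' ∧ 5 * w' ^ 2 + 11 * z' ^ 2 = 16 * N ∧
      2 * w = -3 * w' - 11 * z' ∧ 2 * z = 5 * w' - 3 * z' := by
  obtain ⟨p, hp⟩ := hdvd
  obtain ⟨q, hq⟩ : (32 : ℤ) ∣ -(3 * z + 5 * w) := by omega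
  have e1 : 2 * w = -3 * p - 11 * q := by omega
  have e2 : 2 * z = 5 * p - 3 * q := by omega
  have e3 : 5 * p ^ 2 + 11 * q ^ 2 = 16 * N := by
    have h1 : 5 * (2 * w) ^ 2 + 11 * (2 * z) ^ 2 = 64 * (16 * N) := by
      linear_combination 4 * hN
    rw [e1, e2] at h1
    linarith
  have hpo : Odd p := by
    by_contra hpe
    rw [Int.not_odd_iff_even] at hpe
    obtain ⟨r, hr⟩ := hpe
    obtain ⟨s, hs⟩ : (2 : ℤ) ∣ q := by omega
    obtain ⟨i, hi⟩ := hw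
    subst hr hs
    have e4 : 5 * r ^ 2 + 11 * s ^ 2 = 4 * N := by linarith
    rcases Int.even_or_odd' r with ⟨x, rfl | rfl⟩ <;>
      rcases Int.even_or_odd' s with ⟨y, rfl | rfl⟩ <;> ring_nf at e4 <;> omega
  refine ⟨p, q, hpo, ?_, e3, e1, e2⟩
  obtain ⟨r, hr⟩ := hpo
  rw [Int.odd_iff]
  omega

theorem dvd_or_dvd_of_norm {w z N : ℤ} (hw : Odd w) (hz : Odd z)
    (hN : 5 * w ^ 2 + 11 * z ^ 2 = 16 * (16 * N)) :
    32 ∣ 11 * z - 3 * w ∨ 32 ∣ 11 * z - 3 * (-w) := by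
  obtain ⟨i, hi⟩ := hw
  obtain ⟨j, hj⟩ := hz
  obtain ⟨x, hx⟩ : (2 : ℤ) ∣ 11 * z - 3 * w := by omega
  obtain ⟨y, hy⟩ : (2 : ℤ) ∣ 11 * z - 3 * (-w) := by omega
  have hxy : x * y = 16 * (44 * N - w ^ 2) := by
    have h1 : (2 * x) * (2 * y) = (11 * z - 3 * w) * (11 * z - 3 * (-w)) := by rw [hx, hy]
    linarith [h1, hN]
  have hsum : (x + y) % 2 = 1 := by omega
  have key : ∀ s t : ℤ, s % 2 = 1 → (16 : ℤ) ∣ s * t → (16 : ℤ) ∣ t := by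
    intro s t hs hd
    have hc : IsCoprime (16 : ℤ) s := by
      have : IsCoprime (2 : ℤ) s :=
        (Int.prime_two.coprime_iff_not_dvd).2 (by omega)
      simpa using this.pow_left (m := 4)
    exact hc.dvd_of_dvd_mul_left hd
  rcases Int.emod_two_eq_zero_or_one x with h0 | h1
  · left
    have := key y x (by omega) ⟨_, by rw [mul_comm]; exact hxy⟩
    omega
  · right
    have := key x y h1 ⟨_, hxy⟩
    omega

/-- All odd solutions of `5 w ^ 2 + 11 z ^ 2 = 16 ^ (n + 1)`. -/
theorem eq_lehmer_of_norm (n : ℕ) : ∀ w z : ℤ, Odd w → Odd z →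
    5 * w ^ 2 + 11 * z ^ 2 = 16 ^ (n + 1) →
    (w = lehmerW n ∨ w = -lehmerW n) ∧ (z = lehmerZ n ∨ z = -lehmerZ n) := by
  induction n with
  | zero =>
    intro w z hw hz h
    norm_num at h
    simp only [lehmerW, lehmerZ]
    have hw1 : w ≤ 1 := by nlinarith [sq_nonneg z]
    have hw2 : -1 ≤ w := by nlinarith [sq_nonneg z]
    have hz1 : z ≤ 1 := by nlinarith [sq_nonneg w]
    have hz2 : -1 ≤ z := by nlinarith [sq_nonneg w]
    rw [Int.odd_iff] at hw hz
    omega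
  | succ n ih =>
    have main : ∀ w z : ℤ, Odd w → Odd z → 5 * w ^ 2 + 11 * z ^ 2 = 16 ^ (n + 1 + 1) →
        32 ∣ 11 * z - 3 * w → (w = lehmerW (n + 1) ∨ w = -lehmerW (n + 1)) ∧
          (z = lehmerZ (n + 1) ∨ z = -lehmerZ (n + 1)) := by
      intro w z hw hz h hd
      obtain ⟨p, q, hp, hq, hpq, e1, e2⟩ :=
        exists_descent (N := 16 ^ n) hw (by rw [h]; ring) hd
      have hih := ih p q hp hq (by rw [hpq]; ring)
      have h1 := lehmer_step n
      have h2 := lehmerW_sub_lehmerZ n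
      rw [Int.odd_iff] at hw
      rcases hih with ⟨hp' | hp', hq' | hq'⟩ <;> omega
    intro w z hw hz h
    rcases dvd_or_dvd_of_norm (N := 16 ^ n) hw hz (by rw [h]; ring) with hd | hd
    · exact main w z hw hz h hd
    · have := main (-w) z hw.neg hz (by rw [neg_sq, h]) hd
      omega

theorem lehmerZ_add_eleven (n : ℕ) :
    lehmerZ (n + 11) = -2922960 * lehmerZ n + 526361 * lehmerZ (n + 1) := by
  simp only [lehmerZ]
  ring

theorem dvd_lehmerZ_of_eleven_dvd (n : ℕ) : (11 : ℤ) ∣ lehmerZ n → (109 : ℤ) ∣ lehmerZ n := by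
  induction n using Nat.strong_induction_on with
  | _ n ih =>
    rcases lt_or_ge n 11 with hn | hn
    · have : ∀ m < 11, (11 : ℤ) ∣ lehmerZ m → (109 : ℤ) ∣ lehmerZ m := by decide +kernel
      exact this n hn
    · obtain ⟨m, rfl⟩ := Nat.exists_eq_add_of_le' hn
      have hm := ih m (by omega)
      have := lehmerZ_add_eleven m
      omega

theorem lehmerZ_add_period (n : ℕ) :
    (82048 : ℤ) ∣ lehmerZ (n + 162) - lehmerZ (n + 2) ∧
      (82048 : ℤ) ∣ lehmerZ (n + 163) - lehmerZ (n + 3) := by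
  induction n with
  | zero => decide +kernel
  | succ n ih =>
    refine ⟨by convert ih.2 using 3, ?_⟩
    have h1 : lehmerZ (n + 1 + 163) = -3 * lehmerZ (n + 163) - 16 * lehmerZ (n + 162) := rfl
    have h2 : lehmerZ (n + 1 + 3) = -3 * lehmerZ (n + 3) - 16 * lehmerZ (n + 2) := rfl
    omega

theorem lehmerZ_ne_one (n : ℕ) : lehmerZ (n + 2) ≠ 1 ∧ lehmerZ (n + 2) ≠ -1 := by
  have key : ∀ n : ℕ, lehmerZ (n + 2) % 82048 ≠ 1 ∧ lehmerZ (n + 2) % 82048 ≠ 82047 := by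
    intro n
    induction n using Nat.strong_induction_on with
    | _ n ih =>
      rcases lt_or_ge n 160 with hn | hn
      · have : ∀ m < 160, lehmerZ (m + 2) % 82048 ≠ 1 ∧ lehmerZ (m + 2) % 82048 ≠ 82047 := by
          decide +kernel
        exact this n hn
      · obtain ⟨m, rfl⟩ := Nat.exists_eq_add_of_le' hn
        have hm := ih m (by omega)
        have hp : (82048 : ℤ) ∣ lehmerZ (m + 160 + 2) - lehmerZ (m + 2) :=
          (lehmerZ_add_period m).1
        omega
  have := key n
  omega

/-- `5 w ^ 2 + 11 ^ (2 k + 1) = 16 ^ (n + 1)` has only solutions with `k = 0` and `n ≤ 1`. -/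
theorem eq_zero_and_le_one_of_norm {w : ℤ} {k n : ℕ} (hw : Odd w)
    (h : 5 * w ^ 2 + 11 ^ (2 * k + 1) = 16 ^ (n + 1)) : k = 0 ∧ n ≤ 1 := by
  have hz : Odd ((11 : ℤ) ^ k) := Odd.pow (by decide)
  have hs := (eq_lehmer_of_norm n w (11 ^ k) hw hz (by rw [← h]; ring)).2
  have hk : k = 0 := by
    by_contra hk
    have h11 : (11 : ℤ) ∣ 11 ^ k := dvd_pow_self _ hk
    have h109 : (109 : ℤ) ∣ 11 ^ k := by
      have := dvd_lehmerZ_of_eleven_dvd n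
      omega
    have hp : Prime (109 : ℤ) := by norm_num
    have := hp.dvd_of_dvd_pow h109
    omega
  subst hk
  refine ⟨rfl, ?_⟩
  by_contra hn
  obtain ⟨m, rfl⟩ := Nat.exists_eq_add_of_le' (show 2 ≤ n by omega)
  have := lehmerZ_ne_one m
  rw [pow_zero] at hs
  omega

theorem nineteen_dvd_of_quartic {u v : ℤ}
    (h : (19 : ℤ) ∣ 5 * u ^ 4 - 20 * u ^ 2 * v ^ 2 + 4 * v ^ 4) :
    (19 : ℤ) ∣ u ∧ (19 : ℤ) ∣ v := by
  have key : ∀ x y : ZMod 19, 5 * x ^ 4 - 20 * x ^ 2 * y ^ 2 + 4 * y ^ 4 = 0 →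
      x = 0 ∧ y = 0 := by decide +kernel
  have h0 := (ZMod.intCast_zmod_eq_zero_iff_dvd _ 19).2 (by exact_mod_cast h)
  push_cast at h0
  have := key u v h0
  exact ⟨by exact_mod_cast (ZMod.intCast_zmod_eq_zero_iff_dvd u 19).1 this.1,
    by exact_mod_cast (ZMod.intCast_zmod_eq_zero_iff_dvd v 19).1 this.2⟩

theorem nineteen_dvd_of_sum {u z : ℤ} (h : (19 : ℤ) ∣ 5 * u ^ 4 + 11 * z ^ 2) :
    (19 : ℤ) ∣ u := by
  have key : ∀ x y : ZMod 19, 5 * x ^ 4 + 11 * y ^ 2 = 0 → x = 0 := by decide +kernel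
  have h0 := (ZMod.intCast_zmod_eq_zero_iff_dvd _ 19).2 (by exact_mod_cast h)
  push_cast at h0
  exact_mod_cast (ZMod.intCast_zmod_eq_zero_iff_dvd u 19).1 (key u z h0)

theorem odd_exponent_of_quartic {u v : ℤ} {b : ℕ} (hu : Odd u)
    (h : 5 * u ^ 4 - 20 * u ^ 2 * v ^ 2 + 4 * v ^ 4 = -(11 : ℤ) ^ b) : Odd b := by
  by_contra hb
  rw [Nat.not_odd_iff_even] at hb
  obtain ⟨k, rfl⟩ := hb
  obtain ⟨i, rfl⟩ := hu
  obtain ⟨j, hj⟩ : Odd ((11 : ℤ) ^ k) := Odd.pow (by decide)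
  have h4 : (5 * (2 * i + 1) ^ 4 + (2 * j + 1) ^ 2 : ℤ) =
      4 * (5 * (2 * i + 1) ^ 2 * v ^ 2 - v ^ 4) := by
    rw [← hj]
    linear_combination h
  ring_nf at h4
  omega

theorem stmt_15 (u v : ℤ) (hu : Odd u)
    (hv : ∃ a e : ℕ, v = 2 ^ a * 19 ^ e ∨ v = -(2 ^ a * 19 ^ e))
    (hgcd : IsCoprime u v) (b c : ℕ)
    (h : 5 * u ^ 4 - 20 * u ^ 2 * v ^ 2 + 4 * v ^ 4 =
      -((11 : ℤ) ^ b * 19 ^ c)) :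
    u ^ 2 = 1 ∧ (v ^ 2 = 1 ∨ v ^ 2 = 4) ∧ b = 1 ∧ c = 0 := by
  have hcop : ¬ ((19 : ℤ) ∣ u ∧ (19 : ℤ) ∣ v) := fun hd => by
    have := Int.isUnit_iff.1 (hgcd.isUnit_of_dvd' hd.1 hd.2)
    omega
  have hc : c = 0 := by
    by_contra hc
    apply hcop
    apply nineteen_dvd_of_quartic
    rw [h]
    exact ((dvd_pow_self _ hc).mul_left _).neg_right
  subst hc
  rw [pow_zero, mul_one] at h
  obtain ⟨k, rfl⟩ := odd_exponent_of_quartic hu h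
  obtain ⟨a, e, hv⟩ := hv
  have he : e = 0 := by
    by_contra he
    have h19 : (19 : ℤ) ∣ v := by
      have : (19 : ℤ) ∣ 2 ^ a * 19 ^ e := (dvd_pow_self _ he).mul_left _
      omega
    refine hcop ⟨nineteen_dvd_of_sum (z := 11 ^ k) ?_, h19⟩
    have : 5 * u ^ 4 + 11 * (11 ^ k) ^ 2 = v * (20 * u ^ 2 * v - 4 * v ^ 3) := by
      linear_combination h
    rw [this]
    exact h19.mul_right _
  subst he
  rw [pow_zero, mul_one] at hv
  have hv2 : v ^ 2 = 4 ^ a := by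
    rcases hv with rfl | rfl
    · rw [← pow_mul, mul_comm, pow_mul]; norm_num
    · rw [neg_sq, ← pow_mul, mul_comm, pow_mul]; norm_num
  have hw : Odd (u ^ 2 - 2 * v ^ 2) := hu.pow.sub_even (even_two_mul _)
  have h16 : (16 : ℤ) ^ (a + 1) = 16 * (v ^ 2) ^ 2 := by
    rw [hv2, ← pow_mul, mul_comm a, pow_mul, pow_succ]
    norm_num [mul_comm]
  obtain ⟨rfl, ha⟩ := eq_zero_and_le_one_of_norm (k := k) (n := a) hw (by
    rw [h16]; linear_combination h)
  have hu4 : u ^ 4 = (u ^ 2) ^ 2 := by ring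
  have hv4 : v ^ 4 = (v ^ 2) ^ 2 := by ring
  rw [hu4, hv4] at h
  have hsq : ∀ n : ℤ, n = 3 ∨ n = 15 → u ^ 2 ≠ n := by
    intro n hn hun
    obtain ⟨i, rfl⟩ := hu
    ring_nf at hun
    omega
  interval_cases a
  · rw [pow_zero] at hv2
    rw [hv2] at h
    have hf : (u ^ 2 - 1) * (u ^ 2 - 3) = 0 := by
      norm_num at h
      linarith
    rcases mul_eq_zero.1 hf with h1 | h1
    · exact ⟨by linarith, Or.inl hv2, rfl, rfl⟩
    · exact absurd (by linarith) (hsq 3 (by norm_num))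
  · rw [pow_one] at hv2
    rw [hv2] at h
    have hf : (u ^ 2 - 1) * (u ^ 2 - 15) = 0 := by
      norm_num at h
      linarith
    rcases mul_eq_zero.1 hf with h1 | h1
    · exact ⟨by linarith, Or.inr hv2, rfl, rfl⟩
    · exact absurd (by linarith) (hsq 15 (by norm_num))
end

section
/- Let u be an even integer and v an integer of the form v = ±19^e with e ≥ 0, with gcd(u, v) = 1, and let b, c ≥ 0 be integers such that 5u⁴ − 190u²v² + 361v⁴ = 11^b·19^c. Then either u = 0, v² = 1, b = 0 and c = 2, or u² = 36, v² = 1, b = 0 and c = 0. -/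
/-- The `n`-th solution, modulo `361 * 229`, of the negative Pell equation `y ^ 2 + 1 = 5 * x ^ 2`
obtained from the solution `(2, 1)` by repeated multiplication by `9 + 4 * √5`. -/
def pellMod : ℕ → ℕ × ℕ
  | 0 => (2, 1)
  | n + 1 => ((9 * (pellMod n).1 + 20 * (pellMod n).2) % 82669,
      (4 * (pellMod n).1 + 9 * (pellMod n).2) % 82669)

lemma pellMod_add_period (n : ℕ) : pellMod (n + 342) = pellMod n := by
  induction n with
  | zero => decide +kernel
  | succ n ih => rw [Nat.add_right_comm, pellMod, ih, pellMod]

lemma dvd_pellMod (n : ℕ) (h : 361 ∣ (pellMod n).1) : 229 ∣ (pellMod n).1 := by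
  have key : ∀ k < 342, 361 ∣ (pellMod k).1 → 229 ∣ (pellMod k).1 := by decide +kernel
  have hn : pellMod n = pellMod (n % 342) :=
    (Function.Periodic.map_mod_nat pellMod_add_period n).symm
  rw [hn] at h ⊢
  exact key _ (Nat.mod_lt _ (by norm_num)) h

lemma exists_pellMod (x : ℕ) : ∀ y : ℕ, y ^ 2 + 1 = 5 * x ^ 2 →
    ∃ n, pellMod n = (y % 82669, x % 82669) := by
  induction x using Nat.strong_induction_on with
  | _ x ih =>
    intro y hxy
    rcases Nat.lt_or_ge x 5 with hx | hx
    · have hy : y < 10 := by nlinarith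
      interval_cases x <;> interval_cases y <;> simp at hxy
      exact ⟨0, rfl⟩
    · have h1 : 20 * x ≤ 9 * y := by
        by_contra! hlt
        nlinarith
      have h2 : 4 * y ≤ 9 * x := by
        by_contra! hlt
        nlinarith
      have h3 : 2 * x < y := by
        by_contra! hle
        nlinarith
      obtain ⟨y', hy'⟩ := Nat.exists_eq_add_of_le h1
      obtain ⟨x', hx'⟩ := Nat.exists_eq_add_of_le h2
      have ex : x = 4 * y' + 9 * x' := by omega
      have ey : y = 9 * y' + 20 * x' := by omega
      obtain ⟨n, hn⟩ := ih x' (by omega) y' (by subst ex ey; nlinarith)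
      refine ⟨n + 1, ?_⟩
      rw [pellMod, hn, ex, ey]
      ext <;> simp [Nat.add_mod, Nat.mul_mod]

lemma dvd_of_sq_add_one_eq_five_mul_sq {x y : ℕ} (hxy : y ^ 2 + 1 = 5 * x ^ 2) (hy : 361 ∣ y) :
    229 ∣ y := by
  obtain ⟨n, hn⟩ := exists_pellMod x y hxy
  have := dvd_pellMod n
  rw [hn] at this
  simp only at this
  omega

lemma exists_of_sq_add_sq_eq_five_mul_sq_aux {w y x : ℤ} (hw : Odd w) (hy : Even y)
    (hwy : IsCoprime w y) (hx : 0 < x) (h : w ^ 2 + y ^ 2 = 5 * x ^ 2) (h5 : 5 ∣ 2 * w + y) :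
    ∃ m n : ℤ, IsCoprime m n ∧ x = m ^ 2 + n ^ 2 ∧ x % 4 = 1 ∧
      w = 4 * m * n - m ^ 2 + n ^ 2 ∧ y = 2 * m * n + 2 * m ^ 2 - 2 * n ^ 2 := by
  obtain ⟨a, ha⟩ := h5
  obtain ⟨b, hb⟩ : ∃ b, b = 2 * a - w := ⟨_, rfl⟩
  obtain rfl : w = 2 * a - b := by omega
  obtain rfl : y = a + 2 * b := by omega
  have hb1 : b % 2 = 1 := by
    rw [Int.odd_iff] at hw
    omega
  have hab : IsCoprime b a := by
    obtain ⟨p, q, hpq⟩ := hwy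
    exact ⟨2 * q - p, 2 * p + q, by linear_combination hpq⟩
  obtain ⟨m, n, h1, h2, h3, h4, h5, -⟩ := PythagoreanTriple.coprime_classification' (x := b) (y := a)
    (z := x) (by unfold PythagoreanTriple; linarith) (Int.isCoprime_iff_gcd_eq_one.mp hab) hb1 hx
  refine ⟨m, n, Int.isCoprime_iff_gcd_eq_one.mpr h4, h3, ?_, by rw [h1, h2]; ring,
    by rw [h1, h2]; ring⟩
  rw [h3]
  rcases h5 with ⟨hm, hn⟩ | ⟨hm, hn⟩
  · obtain ⟨p, rfl⟩ := Int.even_iff.mpr hm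
    have := Int.sq_mod_four_eq_one_of_odd (Int.odd_iff.mpr hn)
    ring_nf at this ⊢
    omega
  · obtain ⟨p, rfl⟩ := Int.even_iff.mpr hn
    have := Int.sq_mod_four_eq_one_of_odd (Int.odd_iff.mpr hm)
    ring_nf at this ⊢
    omega

/-- Parametrization of the primitive solutions of `w ^ 2 + y ^ 2 = 5 * x ^ 2` with `w` odd. -/
lemma exists_of_sq_add_sq_eq_five_mul_sq {w y x : ℤ} (hw : Odd w) (hy : Even y)
    (hwy : IsCoprime w y) (hx : 0 < x) (h : w ^ 2 + y ^ 2 = 5 * x ^ 2) :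
    ∃ m n : ℤ, IsCoprime m n ∧ x = m ^ 2 + n ^ 2 ∧ x % 4 = 1 ∧
      (w = 4 * m * n - m ^ 2 + n ^ 2 ∨ -w = 4 * m * n - m ^ 2 + n ^ 2) ∧
      y = 2 * m * n + 2 * m ^ 2 - 2 * n ^ 2 := by
  have h5 : (5 : ℤ) ∣ (2 * w + y) * (2 * -w + y) :=
    ⟨x ^ 2 - w ^ 2, by linear_combination h⟩
  rcases (Int.prime_iff_natAbs_prime.mpr (by norm_num) : Prime (5 : ℤ)).dvd_or_dvd h5 with h5 | h5
  · obtain ⟨m, n, h1, h2, h3, h4, h6⟩ :=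
      exists_of_sq_add_sq_eq_five_mul_sq_aux hw hy hwy hx h h5
    exact ⟨m, n, h1, h2, h3, Or.inl h4, h6⟩
  · obtain ⟨m, n, h1, h2, h3, h4, h6⟩ :=
      exists_of_sq_add_sq_eq_five_mul_sq_aux hw.neg hy hwy.neg_left hx (by rwa [neg_sq]) h5
    exact ⟨m, n, h1, h2, h3, Or.inr h4, h6⟩

lemma exists_sq_of_mul_eq_sq {a b c : ℤ} (hab : IsCoprime a b) (ha : 0 < a)
    (h : a * b = c ^ 2) : ∃ d : ℤ, a = d ^ 2 := by
  obtain ⟨d, hd | hd⟩ := Int.sq_of_gcd_eq_one (Int.isCoprime_iff_gcd_eq_one.mp hab) h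
  · exact ⟨d, hd⟩
  · nlinarith [sq_nonneg d]

lemma sq_emod_eight_of_odd {a : ℤ} (ha : Odd a) : a ^ 2 % 8 = 1 := by
  have := Int.eight_dvd_sq_sub_one_of_odd ha
  omega

lemma not_eleven_dvd_of_pow_four_sub {s t h : ℤ} (hs : Odd s) (ht : Odd t) (hh : Odd h)
    (hsh : IsCoprime s h) (heq : s ^ 4 - 5 * (2 * t) ^ 4 = h ^ 4) : ¬ 11 ∣ h := by
  intro hdvd
  have hs11 : ¬ (11 : ℤ) ∣ s := fun hd ↦ by
    have := hsh.isUnit_of_dvd' hd hdvd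
    norm_num [Int.isUnit_iff] at this
  have hs8 := sq_emod_eight_of_odd hs
  have hh8 := sq_emod_eight_of_odd hh
  obtain ⟨V, hV⟩ : ∃ V, s ^ 2 - h ^ 2 = 8 * V := ⟨(s ^ 2 - h ^ 2) / 8, by omega⟩
  obtain ⟨U, hU⟩ : ∃ U, U = 4 * V + h ^ 2 := ⟨_, rfl⟩
  have hUpos : 0 < U := by
    have : h ≠ 0 := by rintro rfl; simp at hh
    have : 0 < h ^ 2 := by positivity
    nlinarith [sq_nonneg s]
  have hUV : U * V = 5 * t ^ 4 := by
    have : 16 * (U * V) = 16 * (5 * t ^ 4) := by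
      rw [hU]
      linear_combination heq - (s ^ 2 + h ^ 2 + 8 * V) * hV
    linarith
  have hcop : IsCoprime U V := by
    obtain ⟨p, q, hpq⟩ := hsh.pow (m := 2) (n := 2)
    exact ⟨p + q, 4 * p - 4 * q, by rw [hU]; linear_combination hpq - p * hV⟩
  have h5 : (5 : ℤ) ∣ U * V := ⟨_, hUV⟩
  rcases (Int.prime_iff_natAbs_prime.mpr (by norm_num) : Prime (5 : ℤ)).dvd_or_dvd h5 with h5 | h5
  · obtain ⟨U', rfl⟩ := h5
    obtain ⟨m, rfl⟩ := exists_sq_of_mul_eq_sq (a := U') (b := V) (c := t ^ 2)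
      (hcop.of_mul_left_right) (by omega) (by linarith)
    have key : ∀ s m : ZMod 11, s ^ 2 = 10 * m ^ 2 → s = 0 := by decide
    have hsum : s ^ 2 + h ^ 2 = 10 * m ^ 2 := by linarith
    have hcast := congrArg (Int.cast : ℤ → ZMod 11) hsum
    push_cast at hcast
    rw [(ZMod.intCast_zmod_eq_zero_iff_dvd h 11).mpr hdvd] at hcast
    exact hs11 ((ZMod.intCast_zmod_eq_zero_iff_dvd s 11).mp (key s m (by simpa using hcast)))
  · obtain ⟨V', rfl⟩ := h5
    have hUV' : U * V' = (t ^ 2) ^ 2 := by linarith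
    have hodd : Odd (U * V') := by rw [hUV']; exact (ht.pow).pow
    obtain ⟨m, rfl⟩ := exists_sq_of_mul_eq_sq hcop.of_mul_right_right hUpos hUV'
    rw [Int.odd_mul, Int.odd_pow' two_ne_zero] at hodd
    have := sq_emod_eight_of_odd hodd.1
    have := Int.odd_iff.mp hodd.2
    omega

lemma eq_one_of_quartic_forms {s r w v : ℤ} {B : ℕ} (hsr : IsCoprime s r)
    (hw : w = 11 ^ B ∨ w = -11 ^ B) (hsw : s ^ 4 - 5 * r ^ 4 = w)
    (hsv : -s ^ 4 + 5 * r ^ 2 * s ^ 2 - 5 * r ^ 4 = 19 * v ^ 2)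
    (hv2 : Odd v) (hv3 : ¬ 3 ∣ v) : w = 1 := by
  have hw3 : w % 3 = 1 := by
    have key : ∀ s r v : ZMod 3, v ≠ 0 → -s ^ 4 + 5 * r ^ 2 * s ^ 2 - 5 * r ^ 4 = 19 * v ^ 2 →
        s ^ 4 - 5 * r ^ 4 = 1 := by decide
    have := key s r v (fun h0 ↦ hv3 ((ZMod.intCast_zmod_eq_zero_iff_dvd v 3).mp h0))
      (by exact_mod_cast congrArg (Int.cast : ℤ → ZMod 3) hsv)
    have h1 : ((w : ℤ) : ZMod 3) = ((1 : ℤ) : ZMod 3) := by rw [← hsw]; exact_mod_cast this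
    exact (ZMod.intCast_eq_intCast_iff' w 1 3).mp h1
  have h11odd : Odd ((11 : ℤ) ^ B) := Odd.pow (by decide)
  have hwodd : Odd w := by rcases hw with rfl | rfl <;> simpa using h11odd
  have hodd4 : ∀ {a : ℤ}, Odd a → a ^ 4 % 16 = 1 := by
    intro a ha
    obtain ⟨q, hq⟩ : ∃ q, a ^ 2 = 8 * q + 1 :=
      ⟨a ^ 2 / 8, by have := sq_emod_eight_of_odd ha; omega⟩
    have : a ^ 4 = 16 * (4 * q ^ 2 + q) + 1 := by
      linear_combination (a ^ 2 + 8 * q + 1) * hq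
    omega
  have heven4 : ∀ {a : ℤ}, Even a → a ^ 4 % 16 = 0 := by
    rintro a ⟨q, rfl⟩
    have : (q + q) ^ 4 = 16 * q ^ 4 := by ring
    omega
  have hw16 : (w % 16 = 1 ∧ Odd s ∧ Even r) ∨ w % 16 = 11 := by
    rw [Int.odd_iff] at hwodd
    rcases Int.even_or_odd s with hs | hs <;> rcases Int.even_or_odd r with hr | hr
    · have := heven4 hs; have := heven4 hr; omega
    · have := heven4 hs; have := hodd4 hr; omega
    · have := hodd4 hs; have := heven4 hr; refine Or.inl ⟨by omega, hs, hr⟩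
    · have := hodd4 hs; have := hodd4 hr; omega
  obtain ⟨k, j, hj, rfl⟩ : ∃ k j, j < 4 ∧ B = 4 * k + j :=
    ⟨B / 4, B % 4, Nat.mod_lt _ (by norm_num), by omega⟩
  have hpow : ((11 : ℤ) ^ (4 * k)) % 48 = 1 := by
    rw [pow_mul]
    exact (Int.ModEq.pow k (show (11 : ℤ) ^ 4 ≡ 1 [ZMOD 48] by decide)).trans (by simp; rfl)
  have hmain : w = 11 ^ (4 * k) ∧ Odd s ∧ Even r := by
    rw [pow_add] at hw
    rcases hw16 with ⟨hw16, hsr2⟩ | hw16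
    · refine ⟨?_, hsr2⟩
      interval_cases j <;> norm_num at hw <;> omega
    · interval_cases j <;> norm_num at hw <;> omega
  obtain ⟨hwk, hs, t, rfl⟩ := hmain
  rw [← two_mul] at hsr hsw hsv
  have ht : Odd t := by
    by_contra hne
    rw [Int.not_odd_iff_even] at hne
    obtain ⟨q, rfl⟩ := hne
    have h1 := hodd4 hs
    have h2 := sq_emod_eight_of_odd hv2
    have h3 : -s ^ 4 + 16 * (5 * q ^ 2 * s ^ 2 - 80 * q ^ 4) = 19 * v ^ 2 := by
      rw [← hsv]; ring
    omega
  rcases Nat.eq_zero_or_pos k with rfl | hk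
  · simpa using hwk
  have h11 : (11 : ℤ) ∣ 11 ^ k := dvd_pow_self _ hk.ne'
  have hprime : Prime (11 : ℤ) := Int.prime_iff_natAbs_prime.mpr (by norm_num)
  have heq : s ^ 4 - 5 * (2 * t) ^ 4 = (11 ^ k) ^ 4 := by rw [hsw, hwk, mul_comm, pow_mul]
  refine absurd h11 (not_eleven_dvd_of_pow_four_sub hs ht (Odd.pow (by decide)) ?_ heq)
  refine IsCoprime.pow_right (IsCoprime.symm ((hprime.coprime_iff_not_dvd).mpr fun hd ↦ ?_))
  have hr5 : (11 : ℤ) ∣ 5 * (2 * t) ^ 4 := by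
    have : 5 * (2 * t) ^ 4 = s ^ 4 - (11 ^ k) ^ 4 := by linarith
    rw [this]
    exact dvd_sub (dvd_pow hd four_ne_zero) (dvd_pow h11 four_ne_zero)
  have hr : (11 : ℤ) ∣ 2 * t :=
    hprime.dvd_of_dvd_pow ((hprime.dvd_or_dvd hr5).resolve_left (by norm_num))
  exact hprime.not_isUnit (hsr.isUnit_of_dvd' hd hr)

lemma eq_zero_of_sq_eq {t w : ℤ} (ht : Even t)
    (h : 1805 * t ^ 4 - 190 * t ^ 2 + 1 = w ^ 2) : t = 0 := by
  by_contra h0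
  obtain ⟨q, rfl⟩ := ht
  have hw : Odd w := by
    rw [← Int.odd_pow' two_ne_zero, ← h]
    exact ⟨14440 * q ^ 4 - 380 * q ^ 2, by ring⟩
  have hpos : 0 < (q + q) ^ 2 := by positivity
  obtain ⟨m, n, -, -, h4, -⟩ := exists_of_sq_add_sq_eq_five_mul_sq (w := w) (y := 2)
    (x := 19 * (q + q) ^ 2 - 1) hw (by decide) (Int.isCoprime_two_right.mpr hw)
    (by linarith) (by rw [← h]; ring)
  ring_nf at h4
  omega

/-- The curve `5 * u ^ 4 - 190 * u ^ 2 * v ^ 2 + 361 * v ^ 4 = w ^ 2` with `v` a power of `19` and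
`w` a power of `11`. -/
lemma eq_of_quartic_eq_sq {u v : ℤ} {e B : ℕ} (hu : Even u) (hv : v ^ 2 = 361 ^ e)
    (hgcd : IsCoprime u v)
    (h : 5 * u ^ 4 - 190 * u ^ 2 * v ^ 2 + 361 * v ^ 4 = ((11 : ℤ) ^ B) ^ 2) :
    u ^ 2 = 36 ∧ v ^ 2 = 1 ∧ B = 0 := by
  have hv2 : Odd v := by
    rw [← Int.odd_pow' two_ne_zero, hv]; exact Odd.pow (by decide)
  have hv3 : ¬ 3 ∣ v := fun hd ↦ by
    have h3 : Prime (3 : ℤ) := Int.prime_three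
    have := hv ▸ dvd_pow hd two_ne_zero
    have := h3.dvd_of_dvd_pow this
    norm_num at this
  have h11odd : Odd ((11 : ℤ) ^ B) := Odd.pow (by decide)
  have hx4 : (u ^ 2 - 19 * v ^ 2) % 4 = 1 := by
    obtain ⟨q, rfl⟩ := hu
    have := Int.sq_mod_four_eq_one_of_odd hv2
    ring_nf
    omega
  have hcop : IsCoprime ((11 : ℤ) ^ B) (38 * v ^ 2) := by
    rw [hv]
    have h38 : IsCoprime (11 : ℤ) 38 := by norm_num
    have h361 : IsCoprime (11 : ℤ) 361 := by norm_num
    exact (h38.mul_right h361.pow_right).pow_left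
  have heq : ((11 : ℤ) ^ B) ^ 2 + (38 * v ^ 2) ^ 2 = 5 * (u ^ 2 - 19 * v ^ 2) ^ 2 := by
    rw [← h]; ring
  have hpos : 0 < u ^ 2 - 19 * v ^ 2 := by
    by_contra! hle
    obtain ⟨m, n, -, -, h4, -⟩ := exists_of_sq_add_sq_eq_five_mul_sq h11odd
      ((by decide : Even (38 : ℤ)).mul_right _) hcop
      (x := -(u ^ 2 - 19 * v ^ 2)) (by omega) (by rw [neg_sq]; exact heq)
    omega
  obtain ⟨m, n, hmn, hx, -, hw, hy⟩ := exists_of_sq_add_sq_eq_five_mul_sq h11odd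
      ((by decide : Even (38 : ℤ)).mul_right _) hcop hpos heq
  have key : ∀ m n : ℤ, 0 < m → IsCoprime m n → m * (2 * m + n) = u ^ 2 →
      ((11 : ℤ) ^ B = 4 * m * n - m ^ 2 + n ^ 2 ∨ -(11 : ℤ) ^ B = 4 * m * n - m ^ 2 + n ^ 2) →
      38 * v ^ 2 = 2 * m * n + 2 * m ^ 2 - 2 * n ^ 2 → B = 0 := by
    intro m n hm hmn hmu hw hy
    have hu0 : u ≠ 0 := by
      rintro rfl
      nlinarith [sq_nonneg v]
    have hcop2 : IsCoprime m (2 * m + n) := by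
      obtain ⟨p, q, hpq⟩ := hmn
      exact ⟨p - 2 * q, q, by linear_combination hpq⟩
    have hm' : 0 < 2 * m + n := by
      have : 0 < m * (2 * m + n) := by rw [hmu]; positivity
      exact pos_of_mul_pos_right this hm.le
    obtain ⟨r, rfl⟩ := exists_sq_of_mul_eq_sq hcop2 hm hmu
    obtain ⟨s, hs⟩ := exists_sq_of_mul_eq_sq hcop2.symm hm' (by rw [mul_comm, hmu])
    obtain rfl : n = s ^ 2 - 2 * r ^ 2 := by linarith
    rw [hs] at hcop2
    have hsr : IsCoprime s r :=
      ((IsCoprime.pow_iff (by norm_num) (by norm_num)).mp hcop2).symm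
    have h1 := eq_one_of_quartic_forms (w := s ^ 4 - 5 * r ^ 4) (v := v) (B := B) hsr
      (by rcases hw with hw | hw
          · left; rw [hw]; ring
          · right; rw [hw]; ring) rfl (by linarith) hv2 hv3
    have h2 : (11 : ℤ) ^ B = 1 := by
      have : (0 : ℤ) < 11 ^ B := by positivity
      rcases hw with hw | hw <;> linarith
    by_contra hB
    have := one_lt_pow₀ (show (1 : ℤ) < 11 by norm_num) hB
    omega
  have hmu : m * (2 * m + n) = u ^ 2 := by linarith
  have hB : B = 0 := by
    rcases lt_trichotomy m 0 with hm | rfl | hm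
    · exact key (-m) (-n) (by omega) hmn.neg_neg (by linarith)
        (by simpa only [mul_neg, neg_mul, neg_neg, neg_sq] using hw)
        (by simpa only [mul_neg, neg_mul, neg_neg, neg_sq] using hy)
    · nlinarith [sq_nonneg v]
    · exact key m n hm hmn hmu hw hy
  subst hB
  have he : e = 0 := by
    by_contra he
    obtain ⟨x, hxe⟩ := Int.eq_ofNat_of_zero_le hpos.le
    have hpell : (38 * 361 ^ e) ^ 2 + 1 = 5 * x ^ 2 := by
      rw [hv] at heq hxe
      rw [hxe] at heq
      zify
      linarith
    have := dvd_of_sq_add_one_eq_five_mul_sq hpell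
      (Dvd.dvd.mul_left (dvd_pow_self _ he) _)
    have h229 : Nat.Prime 229 := by norm_num
    rcases h229.dvd_mul.mp this with h1 | h1
    · norm_num at h1
    · have := h229.dvd_of_dvd_pow h1
      norm_num at this
  subst he
  rw [pow_zero] at hv
  refine ⟨?_, hv, rfl⟩
  rw [hv] at heq hpos
  nlinarith

theorem stmt_16 (u v : ℤ) (hu : Even u)
    (hv : ∃ e : ℕ, v = 19 ^ e ∨ v = -(19 ^ e))
    (hgcd : IsCoprime u v) (b c : ℕ)
    (h : 5 * u ^ 4 - 190 * u ^ 2 * v ^ 2 + 361 * v ^ 4 =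
      (11 : ℤ) ^ b * 19 ^ c) :
    (u = 0 ∧ v ^ 2 = 1 ∧ b = 0 ∧ c = 2) ∨
    (u ^ 2 = 36 ∧ v ^ 2 = 1 ∧ b = 0 ∧ c = 0) := by
  obtain ⟨e, hv⟩ := hv
  have hv2 : v ^ 2 = 361 ^ e := by
    rcases hv with rfl | rfl
    · rw [← pow_mul, mul_comm, pow_mul]; norm_num
    · rw [neg_sq, ← pow_mul, mul_comm, pow_mul]; norm_num
  have hv4 : v ^ 4 = (361 ^ e) ^ 2 := by rw [← hv2]; ring
  have hc : Even c := by
    by_contra hc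
    rw [Nat.not_even_iff_odd] at hc
    have h1 : (5 * u ^ 4 - 190 * u ^ 2 * v ^ 2 + 361 * v ^ 4 : ZMod 5) =
      (11 : ZMod 5) ^ b * 19 ^ c := by exact_mod_cast congrArg (Int.cast : ℤ → ZMod 5) h
    have h2 : (v ^ 4 : ZMod 5) = (361 ^ e) ^ 2 := by
      exact_mod_cast congrArg (Int.cast : ℤ → ZMod 5) hv4
    rw [h2, show (11 : ZMod 5) = 1 by decide, show (19 : ZMod 5) = -1 by decide,
      show (361 : ZMod 5) = 1 by decide, show (190 : ZMod 5) = 0 by decide,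
      show (5 : ZMod 5) = 0 by decide, hc.neg_one_pow] at h1
    simp at h1
    revert h1
    decide
  have hb : Even b := by
    by_contra hb
    rw [Nat.not_even_iff_odd] at hb
    obtain ⟨q, rfl⟩ := hu
    have h1 := congrArg (Int.cast : ℤ → ZMod 8) h
    have h2 : (v ^ 4 : ZMod 8) = (361 ^ e) ^ 2 := by
      exact_mod_cast congrArg (Int.cast : ℤ → ZMod 8) hv4
    obtain ⟨b', rfl⟩ := hb
    obtain ⟨c', rfl⟩ := hc
    push_cast at h1
    rw [← two_mul, ← two_mul, mul_pow, mul_pow, pow_add, pow_mul, pow_mul, h2,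
      show (361 : ZMod 8) = 1 by decide, show (11 : ZMod 8) ^ 2 = 1 by decide,
      show (19 : ZMod 8) ^ 2 = 1 by decide, show (2 : ZMod 8) ^ 4 = 0 by decide,
      show (190 : ZMod 8) * (2 ^ 2 * (q : ZMod 8) ^ 2) = (190 * 2 ^ 2) * q ^ 2 by ring,
      show (190 * 2 ^ 2 : ZMod 8) = 0 by decide] at h1
    simp at h1
    revert h1
    decide
  obtain ⟨b, rfl⟩ := hb
  obtain ⟨c, rfl⟩ := hc
  rcases Nat.eq_zero_or_pos c with rfl | hc
  · right
    obtain ⟨h1, h2, rfl⟩ := eq_of_quartic_eq_sq (B := b) hu hv2 hgcd (by rw [h]; ring)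
    exact ⟨h1, h2, rfl, rfl⟩
  · left
    have hprime : Prime (19 : ℤ) := Int.prime_iff_natAbs_prime.mpr (by norm_num)
    obtain ⟨c, rfl⟩ := Nat.exists_eq_add_of_le hc
    obtain ⟨t, rfl⟩ : (19 : ℤ) ∣ u := by
      have : (19 : ℤ) ∣ 5 * u ^ 4 :=
        ⟨11 ^ b * 11 ^ b * 19 ^ (2 * c + 1) + 10 * u ^ 2 * v ^ 2 - 19 * v ^ 4, by
          linear_combination h⟩
      exact hprime.dvd_of_dvd_pow ((hprime.dvd_or_dvd this).resolve_left (by norm_num))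
    have he : e = 0 := by
      by_contra he
      refine hprime.not_isUnit (hgcd.isUnit_of_dvd' (Dvd.intro t rfl) ?_)
      rcases hv with rfl | rfl
      · exact dvd_pow_self _ he
      · exact (dvd_pow_self _ he).neg_right
    subst he
    rw [pow_zero] at hv2
    have hv4' : v ^ 4 = 1 := by rw [hv4]; norm_num
    have ht : Even t := by
      rw [Int.even_mul] at hu
      exact hu.resolve_left (by decide)
    have hmain : 1805 * t ^ 4 - 190 * t ^ 2 + 1 = (11 ^ b * 19 ^ c) ^ 2 := by
      have : 361 * (1805 * t ^ 4 - 190 * t ^ 2 + 1) = 361 * ((11 : ℤ) ^ b * 19 ^ c) ^ 2 := by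
        rw [hv2, hv4'] at h
        linear_combination h
      linarith
    have h0 := eq_zero_of_sq_eq ht hmain
    subst h0
    have hpow : 11 ^ b * 19 ^ c = 1 := by
      have : ((11 : ℤ) ^ b * 19 ^ c) ^ 2 = 1 := by rw [← hmain]; norm_num
      have h1 : (11 ^ b * 19 ^ c) ^ 2 = 1 := by exact_mod_cast this
      simpa using h1
    rw [mul_eq_one] at hpow
    simp at hpow
    obtain ⟨rfl, rfl⟩ := hpow
    exact ⟨by norm_num, hv2, rfl, rfl⟩
end
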